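/- arXiv:0905.4526 — 3 statements merged into one kernel-verified Lean document; each statement's English description precedes it below -/
import Mathlib

section
/- Let n be a natural number and let G be a group acting on Euclidean space ℝⁿ by homeomorphisms, such that the action is continuous, free, and properly discontinuous. Then G is torsion-free, i.e., every nontrivial element of G has infinite order. -/
open Pointwise

section Tower

/-- If finitely many homotopies `h i`, each commuting with `D` on the piece `A i` and contracting
the periodic complex formed by the `θ k`, are available on all pieces, then the bottom of a long
enough tower `D (x (k + 1)) = θ (k + 1) (x k)` supported on the pieces is a boundary modulo the
image of `θ 0`. -/
theorem exists_eq_boundary_add_of_tower {ι C : Type*} [DecidableEq ι] [AddCommGroup C]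
    (D : Module.End ℤ C) (θ : ℕ → Module.End ℤ C) (h : ι → ℕ → Module.End ℤ C)
    (A : ι → ℕ → Submodule ℤ C)
    (hDD : ∀ c, D (D c) = 0) (hDθ : ∀ k c, D (θ k c) = θ k (D c))
    (hθθ : ∀ k c, θ (k + 1) (θ k c) = 0)
    (hid : ∀ i k j m, ∀ c ∈ A j m, h i (k + 1) (θ (k + 1) c) + θ k (h i k c) = c)
    (hAh : ∀ i k j m, ∀ c ∈ A j m, h i k c ∈ A j m)
    (hAD : ∀ j m, ∀ c ∈ A j (m + 1), D c ∈ A j m)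
    (hcomm : ∀ i k m, ∀ c ∈ A i (m + 1), h i k (D c) = D (h i k c))
    (S : Finset ι) (x : ℕ → C) (hx : ∀ k ≤ S.card, x k ∈ ⨆ i ∈ S, A i k)
    (hDx : ∀ k < S.card, D (x (k + 1)) = θ (k + 1) (x k)) :
    ∃ z w, x 0 = D z + θ 0 w := by
  induction S using Finset.induction_on generalizing x with
  | empty => exact ⟨0, 0, by simpa using hx 0⟩
  | insert i S hi ih =>
    rw [Finset.card_insert_of_notMem hi] at hx hDx
    have hid' : ∀ k, ∀ m ≤ S.card + 1,
        h i (k + 1) (θ (k + 1) (x m)) + θ k (h i k (x m)) = x m := by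
      intro k m hm
      have hle : ⨆ j ∈ insert i S, A j m ≤
          LinearMap.eqLocus (h i (k + 1) * θ (k + 1) + θ k * h i k) LinearMap.id :=
        iSup₂_le fun j _ c hc => hid i k j m c hc
      exact hle (hx m hm)
    let E : ℕ → Module.End ℤ C := fun k => h i (k + 1) * D - D * h i (k + 1)
    have hE : ∀ k c, E k c = h i (k + 1) (D c) - D (h i (k + 1) c) := fun _ _ => rfl
    obtain ⟨z, w, hzw⟩ := ih (fun k => E k (x (k + 1))) (by
      intro k hk
      have hxk := hx (k + 1) (by omega)
      rw [Finset.iSup_insert] at hxk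
      obtain ⟨a, ha, b, hb, hab⟩ := Submodule.mem_sup.1 hxk
      have hEa : E k a = 0 := by rw [hE, hcomm i _ k a ha, sub_self]
      have hle : ⨆ j ∈ S, A j (k + 1) ≤ (⨆ j ∈ S, A j k).comap (E k) := by
        refine iSup₂_le fun j hj c hc => ?_
        refine (le_biSup (fun j => A j k) hj : A j k ≤ _) ?_
        exact sub_mem (hAh _ _ _ _ _ (hAD _ _ _ hc)) (hAD _ _ _ (hAh _ _ _ _ _ hc))
      rw [← hab, map_add, hEa, zero_add]
      exact hle hb) (by
      intro k hk
      simp only [hE, map_sub, hDD, sub_zero]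
      rw [hDx (k + 1) (by omega), hDx k (by omega), ← hDθ]
      have h1 := hid' (k + 1) (k + 1) (by omega)
      have h2 := congrArg (θ (k + 1)) (hid' k k (by omega))
      rw [map_add, hθθ, add_zero] at h2
      rw [h2, ← hDx k (by omega), ← map_sub]
      congr 1
      exact eq_sub_of_add_eq h1)
    refine ⟨z + h i 1 (x 1), w + h i 0 (x 0), ?_⟩
    have h0 := hid' 0 0 (by omega)
    simp only [hE, zero_add, hDx 0 (Nat.succ_pos _)] at hzw h0
    calc x 0 = h i 1 (θ 1 (x 0)) + θ 0 (h i 0 (x 0)) := h0.symm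
      _ = D z + θ 0 w + D (h i 1 (x 1)) + θ 0 (h i 0 (x 0)) := by
        rw [sub_eq_iff_eq_add.1 hzw]
      _ = D (z + h i 1 (x 1)) + θ 0 (w + h i 0 (x 0)) := by
        rw [map_add, map_add]; abel

end Tower

section CyclicHomotopy

variable {R : Type*} [Ring R]

/-- The partner of the projection `s` in the contraction of the periodic complex of a cyclic
group with generator `T` of order `p` and inverse `T'`. -/
def cyclicHomotopy (T T' s : R) (p : ℕ) : R :=
  ∑ i ∈ Finset.range p, T ^ i * s * (∑ j ∈ Finset.range (i + 1), T' ^ j - 1)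

variable {T T' : R} (s : R)

theorem sum_pow_inv_eq {p : ℕ} (hT : T * T' = 1) (hTp : T ^ p = 1) :
    ∑ i ∈ Finset.range p, T' ^ i = ∑ i ∈ Finset.range p, T ^ i := by
  have hc : ∀ i, T ^ i * T' ^ i = 1 := by
    intro i
    induction i with
    | zero => simp
    | succ i ih => rw [pow_succ, pow_succ', mul_assoc, ← mul_assoc T, hT, one_mul, ih]
  have hstep : ∀ i ∈ Finset.range p, T' ^ i = T * T ^ (p - 1 - i) := by
    intro i hi
    have hi := Finset.mem_range.1 hi
    rw [← pow_succ', ← one_mul (T' ^ i), ← hTp, show p = (p - 1 - i + 1) + i by omega, pow_add,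
      mul_assoc, hc, mul_one]
    congr 1; omega
  rw [Finset.sum_congr rfl hstep, ← Finset.mul_sum,
    Finset.sum_range_reflect (fun i => T ^ i) p]
  have := Finset.sum_range_succ' (fun i => T ^ i) p
  rw [Finset.sum_range_succ, hTp, pow_zero] at this
  rw [Finset.mul_sum, add_right_cancel this]
  exact Finset.sum_congr rfl fun i _ => (pow_succ' T i).symm

theorem cyclicHomotopy_mul (p : ℕ) (hT : T' * T = 1) :
    (∑ i ∈ Finset.range p, T ^ i) * s + cyclicHomotopy T T' s p * (1 - T) =
      ∑ i ∈ Finset.range p, T ^ i * s * T' ^ i := by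
  have hρ : ∀ i, (∑ j ∈ Finset.range (i + 1), T' ^ j - 1) * (1 - T) = T' ^ i - 1 := by
    intro i
    induction i with
    | zero => simp
    | succ i ih =>
      rw [Finset.sum_range_succ, add_sub_right_comm, add_mul, ih, mul_sub,
        pow_succ T' i, mul_assoc _ T' T, hT, mul_one, mul_one]
      abel
  rw [cyclicHomotopy, Finset.sum_mul, Finset.sum_mul, ← Finset.sum_add_distrib]
  refine Finset.sum_congr rfl fun i _ => ?_
  rw [mul_assoc _ _ (1 - T), hρ]
  noncomm_ring

theorem mul_cyclicHomotopy {p : ℕ} (hT : T * T' = 1) (hTp : T ^ p = 1) :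
    s * (∑ i ∈ Finset.range p, T ^ i) + (1 - T) * cyclicHomotopy T T' s p =
      ∑ i ∈ Finset.range p, T ^ i * s * T' ^ i := by
  have key : ∀ m, (1 - T) * cyclicHomotopy T T' s m =
      ∑ i ∈ Finset.range m, T ^ i * s * T' ^ i - s
        - T ^ m * s * (∑ j ∈ Finset.range m, T' ^ j - 1) := by
    intro m
    induction m with
    | zero => simp [cyclicHomotopy]
    | succ m ih =>
      rw [cyclicHomotopy, Finset.sum_range_succ, mul_add, ← cyclicHomotopy, ih,
        Finset.sum_range_succ (fun i => T ^ i * s * T' ^ i),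
        Finset.sum_range_succ (fun i => T' ^ i),
        pow_succ' T m]
      noncomm_ring
  rw [key, hTp, sum_pow_inv_eq hT hTp]
  noncomm_ring

end CyclicHomotopy

section ListChain

variable {X : Type*}

/-- Integral chains on finite ordered tuples of points, the empty tuple included. -/
abbrev ListChain (X : Type*) := List X →₀ ℤ

namespace ListChain

open Finsupp

theorem hom_ext {f f' : Module.End ℤ (ListChain X)}
    (h : ∀ l, f (single l 1) = f' (single l 1)) : f = f' :=
  Finsupp.lhom_ext' fun l => LinearMap.ext_ring (h l)

theorem map_mem_of_single_mem {f : Module.End ℤ (ListChain X)} {S : Set (List X)}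
    {M : Submodule ℤ (ListChain X)} (h : ∀ l ∈ S, f (single l 1) ∈ M) {c : ListChain X}
    (hc : c ∈ supported ℤ ℤ S) : f c ∈ M := by
  have hle : supported ℤ ℤ S ≤ M.comap f := by
    rw [supported_eq_span_single, Submodule.span_le]
    rintro _ ⟨l, hl, rfl⟩
    exact h l hl
  exact hle hc

theorem eq_of_single_eq {f f' : Module.End ℤ (ListChain X)} {S : Set (List X)}
    (h : ∀ l ∈ S, f (single l 1) = f' (single l 1)) {c : ListChain X}
    (hc : c ∈ supported ℤ ℤ S) : f c = f' c := by
  have := map_mem_of_single_mem (f := f - f') (M := ⊥) (fun l hl => by simp [h l hl]) hc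
  simpa [sub_eq_zero] using this

/-- The cone operator prepending the vertex `a`. -/
noncomputable def cone (a : X) : Module.End ℤ (ListChain X) :=
  lmapDomain ℤ ℤ (List.cons a)

@[simp]
theorem cone_single (a : X) (l : List X) (m : ℤ) : cone a (single l m) = single (a :: l) m := by
  simp [cone]

/-- The boundary of a single tuple. -/
noncomputable def faceSum : List X → ListChain X
  | [] => 0
  | a :: l => single l 1 - cone a (faceSum l)

/-- The boundary operator of the augmented complex of ordered tuples. -/
noncomputable def boundary : Module.End ℤ (ListChain X) :=
  linearCombination ℤ faceSum

theorem boundary_single (l : List X) : boundary (single l 1) = faceSum l := by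
  simp [boundary]

theorem boundary_cone (a : X) (c : ListChain X) :
    boundary (cone a c) = c - cone a (boundary c) := by
  have : boundary * cone a = 1 - cone a * boundary :=
    hom_ext fun l => by simp [boundary_single, faceSum]
  exact LinearMap.congr_fun this c

theorem boundary_boundary (c : ListChain X) : boundary (boundary c) = 0 := by
  have : boundary * boundary = (0 : Module.End ℤ (ListChain X)) := by
    refine hom_ext fun l => ?_
    induction l with
    | nil => simp [boundary_single, faceSum]
    | cons a l ih =>
      simp only [Module.End.mul_apply, boundary_single, LinearMap.zero_apply] at ih
      simp [boundary_single, faceSum, boundary_cone, ih]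
  exact LinearMap.congr_fun this c

theorem faceSum_mem (l : List X) :
    faceSum l ∈ supported ℤ ℤ {l' : List X | l'.length + 1 = l.length ∧ l' ⊆ l} := by
  induction l with
  | nil => exact zero_mem _
  | cons a l ih =>
    refine sub_mem (single_mem_supported _ _ ⟨rfl, List.subset_cons_self _ _⟩) ?_
    refine map_mem_of_single_mem (fun l' hl' => ?_) ih
    rw [cone_single]
    have hlen : (a :: l').length + 1 = (a :: l).length := by simp [hl'.1]
    have hsub := List.cons_subset_cons a hl'.2
    exact single_mem_supported _ _ (And.intro hlen hsub)

/-- The chain map induced by a map of points. -/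
noncomputable def map (f : X → X) : Module.End ℤ (ListChain X) :=
  lmapDomain ℤ ℤ (List.map f)

@[simp]
theorem map_single (f : X → X) (l : List X) (m : ℤ) :
    map f (single l m) = single (l.map f) m := by
  simp [map]

theorem map_cone (f : X → X) (a : X) (c : ListChain X) :
    map f (cone a c) = cone (f a) (map f c) := by
  have : map f * cone a = cone (f a) * map f := hom_ext fun l => by simp
  exact LinearMap.congr_fun this c

theorem boundary_mul_map (f : X → X) : boundary * map f = map f * boundary := by
  refine hom_ext fun l => ?_
  induction l with
  | nil => simp [boundary_single, faceSum]
  | cons a l ih =>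
    simp only [Module.End.mul_apply, boundary_single, map_single] at ih
    simp [boundary_single, faceSum, map_cone, ih]

theorem boundary_map (f : X → X) (c : ListChain X) :
    boundary (map f c) = map f (boundary c) :=
  LinearMap.congr_fun (boundary_mul_map f) c

theorem map_mul_map (f f' : X → X) : map f * map f' = map (f ∘ f') :=
  hom_ext fun l => by simp

theorem map_id : map (id : X → X) = 1 :=
  hom_ext fun l => by simp

theorem map_pow (f : X → X) (i : ℕ) : map f ^ i = map f^[i] := by
  induction i with
  | zero => exact map_id.symm
  | succ i ih => rw [pow_succ, ih, map_mul_map, Function.iterate_succ]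

/-- The prism over a tuple, joining it to its image under `f`. -/
noncomputable def prismSum (f : X → X) : List X → ListChain X
  | [] => 0
  | a :: l => single (a :: f a :: l.map f) 1 - cone a (prismSum f l)

/-- The chain homotopy from the identity to `map f`. -/
noncomputable def prism (f : X → X) : Module.End ℤ (ListChain X) :=
  linearCombination ℤ (prismSum f)

theorem prism_single (f : X → X) (l : List X) : prism f (single l 1) = prismSum f l := by
  simp [prism]

theorem prism_cone (f : X → X) (a : X) (c : ListChain X) :
    prism f (cone a c) = cone a (cone (f a) (map f c)) - cone a (prism f c) := by
  have : prism f * cone a = cone a * cone (f a) * map f - cone a * prism f :=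
    hom_ext fun l => by simp [prism_single, prismSum]
  exact LinearMap.congr_fun this c

theorem boundary_prism (f : X → X) (c : ListChain X) :
    boundary (prism f c) = map f c - c - prism f (boundary c) := by
  have : boundary * prism f = map f - 1 - prism f * boundary := by
    refine hom_ext fun l => ?_
    induction l with
    | nil => simp [boundary_single, prism_single, faceSum, prismSum]
    | cons a l ih =>
      have h1 : single (a :: l) 1 = cone a (single l (1 : ℤ)) := by simp
      simp only [Module.End.mul_apply, LinearMap.sub_apply, Module.End.one_apply] at ih ⊢
      simp only [h1, prism_cone, boundary_cone, map_cone, map_sub, boundary_map, ih]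
      abel
  exact LinearMap.congr_fun this c

theorem prismSum_mem (f : X → X) (l : List X) :
    prismSum f l ∈ supported ℤ ℤ
      {l' : List X | l'.length = l.length + 1 ∧ ∀ b ∈ l', ∃ a ∈ l, b = a ∨ b = f a} := by
  induction l with
  | nil => exact zero_mem _
  | cons a l ih =>
    refine sub_mem (single_mem_supported _ _ ⟨by simp, ?_⟩) ?_
    · simp only [List.mem_cons, List.mem_map]
      rintro b (rfl | rfl | ⟨c, hc, rfl⟩)
      · exact ⟨b, .inl rfl, .inl rfl⟩
      · exact ⟨a, .inl rfl, .inr rfl⟩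
      · exact ⟨c, .inr hc, .inr rfl⟩
    · refine map_mem_of_single_mem (fun l' hl' => ?_) ih
      rw [cone_single]
      refine single_mem_supported _ _ ⟨by simp [hl'.1], ?_⟩
      simp only [List.mem_cons]
      rintro b (rfl | hb)
      · exact ⟨b, .inl rfl, .inl rfl⟩
      · obtain ⟨c, hc, h⟩ := hl'.2 b hb
        exact ⟨c, .inr hc, h⟩

open Classical in
/-- The projection onto the tuples whose first vertex lies in `F`. -/
noncomputable def headProj (F : Set X) : Module.End ℤ (ListChain X) :=
  linearCombination ℤ fun l => if ∃ a ∈ l.head?, a ∈ F then single l 1 else 0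

theorem headProj_single_of_mem {F : Set X} {a : X} {l : List X} (h : a ∈ F) :
    headProj F (single (a :: l) 1) = single (a :: l) 1 := by
  simp [headProj, h]

theorem headProj_single_of_notMem {F : Set X} {a : X} {l : List X} (h : a ∉ F) :
    headProj F (single (a :: l) 1) = 0 := by
  simp [headProj, h]

end ListChain

end ListChain

section Filling

open ListChain Finsupp

variable {E : Type*} [NormedAddCommGroup E] [NormedSpace ℝ E]

/-- Tuples of `k + 1` points of the closed ball of radius `R` with mutual distances below `ε`. -/
def smallLists (E : Type*) [NormedAddCommGroup E] (k : ℕ) (R ε : ℝ) : Set (List E) :=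
  {l | l.length = k + 1 ∧ (∀ a ∈ l, ‖a‖ ≤ R) ∧ ∀ a ∈ l, ∀ b ∈ l, dist a b < ε}

/-- Cycles with small simplices in a ball bound chains with small simplices in the same ball. -/
theorem exists_boundary_eq_of_small {k : ℕ} {R ε : ℝ} (hR : 0 ≤ R) (hε : 0 < ε)
    {z : ListChain E} (hz : z ∈ supported ℤ ℤ (smallLists E k R ε)) (hDz : boundary z = 0) :
    ∃ y ∈ supported ℤ ℤ (smallLists E (k + 1) R (2 * ε)), boundary y = z := by
  obtain ⟨c, hc0, hc1, hcR⟩ : ∃ c : ℝ, 0 ≤ c ∧ c < 1 ∧ (1 - c) * R < ε := by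
    refine ⟨R / (R + ε), by positivity, (div_lt_one (by positivity)).2 (by linarith), ?_⟩
    have : (1 - R / (R + ε)) * R = ε * (R / (R + ε)) := by field_simp; ring
    rw [this]
    exact mul_lt_of_lt_one_right hε ((div_lt_one (by positivity)).2 (by linarith))
  let f : E → E := fun a => c • a
  have hfnorm : ∀ a : E, ‖f a‖ ≤ ‖a‖ := fun a => by
    rw [norm_smul, Real.norm_of_nonneg hc0]
    exact mul_le_of_le_one_left (norm_nonneg _) hc1.le
  have hfdist : ∀ a b : E, dist (f a) (f b) ≤ dist a b := fun a b => by
    rw [dist_smul₀, Real.norm_of_nonneg hc0]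
    exact mul_le_of_le_one_left dist_nonneg hc1.le
  have hfself : ∀ a : E, ‖a‖ ≤ R → dist a (f a) < ε := fun a ha => by
    have : a - f a = (1 - c) • a := by simp [f, sub_smul]
    rw [dist_eq_norm, this, norm_smul, Real.norm_of_nonneg (by linarith)]
    exact (mul_le_mul_of_nonneg_left ha (by linarith)).trans_lt hcR
  have hiter : ∀ i, (map f ^ i) z ∈ supported ℤ ℤ (smallLists E k R ε) := by
    intro i
    induction i with
    | zero => exact hz
    | succ i ih =>
      rw [pow_succ']
      refine map_mem_of_single_mem (f := map f) (fun l hl => ?_) ih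
      rw [map_single]
      refine single_mem_supported _ _ ⟨by simp [hl.1], ?_, ?_⟩
      · simp only [List.forall_mem_map]
        exact fun a ha => (hfnorm a).trans (hl.2.1 a ha)
      · simp only [List.forall_mem_map]
        exact fun a ha b hb => (hfdist a b).trans_lt (hl.2.2 a ha b hb)
  have hprism : ∀ w ∈ supported ℤ ℤ (smallLists E k R ε),
      prism f w ∈ supported ℤ ℤ (smallLists E (k + 1) R (2 * ε)) := by
    intro w hw
    refine map_mem_of_single_mem (fun l hl => ?_) hw
    rw [prism_single]
    refine supported_mono ?_ (prismSum_mem f l)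
    refine fun l' hl' => ⟨by rw [hl'.1, hl.1], ?_, ?_⟩
    · intro b hb
      obtain ⟨a, ha, rfl | rfl⟩ := hl'.2 b hb
      exacts [hl.2.1 _ ha, (hfnorm a).trans (hl.2.1 a ha)]
    · intro b hb b' hb'
      obtain ⟨a, ha, h⟩ := hl'.2 b hb
      obtain ⟨a', ha', h'⟩ := hl'.2 b' hb'
      have h1 := hl.2.2 a ha a' ha'
      have h2 := hfself a (hl.2.1 a ha)
      have h3 := hfself a' (hl.2.1 a' ha')
      have h4 := hfdist a a'
      rcases h with rfl | rfl <;> rcases h' with rfl | rfl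
      · linarith
      · linarith [dist_triangle b a' (f a')]
      · linarith [dist_triangle (f a) a b', dist_comm a (f a)]
      · linarith
  obtain ⟨m, hm⟩ : ∃ m : ℕ, c ^ m * R < ε := by
    have ht : Filter.Tendsto (fun m : ℕ => c ^ m * R) Filter.atTop (nhds (0 * R)) :=
      (tendsto_pow_atTop_nhds_zero_of_lt_one hc0 hc1).mul_const R
    rw [zero_mul] at ht
    exact (ht.eventually_lt_const hε).exists
  have hcyc : ∀ i, boundary ((map f ^ i) z) = 0 := fun i => by
    rw [ListChain.map_pow, boundary_map, hDz, LinearMap.map_zero]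
  have htele : ∀ i, boundary (∑ j ∈ Finset.range i, prism f ((map f ^ j) z)) =
      (map f ^ i) z - z := by
    intro i
    induction i with
    | zero => simp
    | succ i ih =>
      rw [Finset.sum_range_succ, map_add, ih, boundary_prism, hcyc, LinearMap.map_zero, pow_succ',
        Module.End.mul_apply]
      abel
  refine ⟨cone 0 ((map f ^ m) z) - ∑ j ∈ Finset.range m, prism f ((map f ^ j) z),
    sub_mem ?_ (sum_mem fun j _ => hprism _ (hiter j)), ?_⟩
  · have : (cone 0 * map f ^ m : Module.End ℤ (ListChain E)) z ∈
        supported ℤ ℤ (smallLists E (k + 1) R (2 * ε)) := by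
      refine map_mem_of_single_mem (fun l hl => ?_) hz
      rw [ListChain.map_pow, Module.End.mul_apply, map_single, cone_single]
      have hf : ∀ a : E, f^[m] a = c ^ m • a := fun a => by
        rw [smul_iterate]
      have hsmall : ∀ b ∈ (0 : E) :: l.map f^[m], ‖b‖ < ε ∧ ‖b‖ ≤ R := by
        simp only [List.mem_cons, forall_eq_or_imp, List.forall_mem_map, norm_zero]
        refine ⟨⟨hε, hR⟩, fun a ha => ?_⟩
        rw [hf, norm_smul, Real.norm_of_nonneg (by positivity)]
        have ha := hl.2.1 a ha
        exact ⟨(mul_le_mul_of_nonneg_left ha (by positivity)).trans_lt hm,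
          (mul_le_of_le_one_left (norm_nonneg _) (pow_le_one₀ hc0 hc1.le)).trans ha⟩
      refine single_mem_supported _ _ ⟨by simp [hl.1], fun b hb => (hsmall b hb).2, ?_⟩
      intro b hb b' hb'
      linarith [dist_le_norm_add_norm b b', (hsmall b hb).1, (hsmall b' hb').1]
    exact this
  · rw [map_sub, htele, boundary_cone, hcyc, LinearMap.map_zero]
    abel

end Filling

section Action

open ListChain Finsupp

/-- The differentials of the periodic complex of a cyclic group of order `p` generated by `T`:
the norm in even degrees and `1 - T` in odd degrees. -/
def periodicDifferential {R : Type*} [Ring R] (T : R) (p k : ℕ) : R :=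
  if Even k then ∑ i ∈ Finset.range p, T ^ i else 1 - T

theorem periodicDifferential_succ_mul {R : Type*} [Ring R] {T : R} {p : ℕ} (hT : T ^ p = 1)
    (k : ℕ) : periodicDifferential T p (k + 1) * periodicDifferential T p k = 0 := by
  by_cases hk : Even k <;> simp [periodicDifferential, hk, Nat.even_add_one, mul_neg_geom_sum,
    geom_sum_mul_neg, hT]

variable {G X : Type*} [Group G] [MulAction G X]

/-- The action of a group element on chains. -/
noncomputable def chainAct (X : Type*) [MulAction G X] (g : G) : Module.End ℤ (ListChain X) :=
  ListChain.map (g • ·)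

theorem chainAct_mul (g h : G) : chainAct X g * chainAct X h = chainAct X (g * h) := by
  rw [chainAct, chainAct, map_mul_map, chainAct]
  congr 1; funext x; exact (mul_smul g h x).symm

theorem chainAct_one : chainAct X (1 : G) = 1 := by
  rw [chainAct, ← map_id]
  congr 1; funext x; exact one_smul G x

theorem chainAct_pow (g : G) (i : ℕ) : chainAct X g ^ i = chainAct X (g ^ i) := by
  induction i with
  | zero => rw [pow_zero, pow_zero, chainAct_one]
  | succ i ih => rw [pow_succ, ih, chainAct_mul, pow_succ]

theorem chainAct_single (g : G) (l : List X) (m : ℤ) :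
    chainAct X g (single l m) = single (l.map (g • ·)) m :=
  map_single _ _ _

theorem commute_boundary_periodicDifferential (g : G) (p k : ℕ) :
    Commute boundary (periodicDifferential (chainAct X g) p k) := by
  have h : Commute boundary (chainAct X g) := boundary_mul_map _
  rw [periodicDifferential]
  split_ifs
  · exact Commute.sum_right _ _ _ fun i _ => h.pow_right i
  · exact (Commute.one_right _).sub_right h

theorem boundary_periodicDifferential (g : G) (p k : ℕ) (c : ListChain X) :
    boundary (periodicDifferential (chainAct X g) p k c) =
      periodicDifferential (chainAct X g) p k (boundary c) := by
  rw [← Module.End.mul_apply, (commute_boundary_periodicDifferential g p k).eq,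
    Module.End.mul_apply]

theorem periodicDifferential_succ_apply (g : G) (k : ℕ) (c : ListChain X) :
    periodicDifferential (chainAct X g) (orderOf g) (k + 1)
      (periodicDifferential (chainAct X g) (orderOf g) k c) = 0 := by
  rw [← Module.End.mul_apply, periodicDifferential_succ_mul, LinearMap.zero_apply]
  rw [chainAct_pow, pow_orderOf_eq_one, chainAct_one]

/-- Tuples of length `k + 1` contained in a single translate of `V`. -/
def translateLists (G : Type*) [Group G] [MulAction G X] (V : Set X) (k : ℕ) : Set (List X) :=
  {l | l.length = k + 1 ∧ ∃ h : G, ∀ a ∈ l, h • a ∈ V}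

/-- For a free action, a set disjoint from its translates extends to a set of orbit
representatives. -/
theorem exists_orbit_section (hfree : ∀ (g : G) (x : X), g • x = x → g = 1) {V : Set X}
    (hV : ∀ h : G, h ≠ 1 → ∀ x ∈ V, h • x ∉ V) :
    ∃ F : Set X, V ⊆ F ∧ ∀ x : X, ∃! h : G, h • x ∈ F := by
  have hrep : ∀ o : MulAction.orbitRel.Quotient G X, ∃ x : X,
      (Quotient.mk'' x : MulAction.orbitRel.Quotient G X) = o ∧
        ∀ y ∈ V, (Quotient.mk'' y : MulAction.orbitRel.Quotient G X) = o → y = x := by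
    intro o
    by_cases ho : ∃ x ∈ V, (Quotient.mk'' x : MulAction.orbitRel.Quotient G X) = o
    · obtain ⟨x, hx, rfl⟩ := ho
      refine ⟨x, rfl, fun y hy hyx => ?_⟩
      obtain ⟨h, rfl⟩ := MulAction.orbitRel_apply.1 (Quotient.eq''.1 hyx)
      by_cases hh : h = 1
      · simp [hh]
      · exact absurd hy (hV h hh x hx)
    · obtain ⟨x, rfl⟩ := Quotient.exists_rep o
      exact ⟨x, rfl, fun y hy hyx => absurd ⟨y, hy, hyx⟩ ho⟩
  choose c hc hcV using hrep
  refine ⟨Set.range c, fun y hy => ⟨_, (hcV _ y hy rfl).symm⟩, fun x => ?_⟩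
  obtain ⟨h, hh⟩ := MulAction.orbitRel_apply.1 (Quotient.eq''.1 (hc (Quotient.mk'' x)))
  refine ⟨h, ⟨_, hh.symm⟩, ?_⟩
  rintro h' ⟨o, ho⟩
  have ho' : o = Quotient.mk'' x := by
    rw [← hc o, ho]
    exact Quotient.eq''.2 (MulAction.orbitRel_apply.2 ⟨h', rfl⟩)
  have : (h⁻¹ * h') • x = x := by
    have ho : h' • x = c o := ho.symm
    rw [mul_smul, ho, ho', ← show h • x = _ from hh, inv_smul_smul]
  exact (inv_mul_eq_one.1 (hfree _ _ this)).symm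

/-- Operators on chains preserving each `A j m` and commuting with the boundary on
`A i (m + 1)`. -/
def preservingCommuting {ι : Type*} (A : ι → ℕ → Submodule ℤ (ListChain X)) (i : ι) :
    Subring (Module.End ℤ (ListChain X)) where
  carrier := {f | (∀ j m, ∀ c ∈ A j m, f c ∈ A j m) ∧
    ∀ m, ∀ c ∈ A i (m + 1), f (boundary c) = boundary (f c)}
  mul_mem' := fun {a b} ha hb =>
    ⟨fun j m c hc => ha.1 j m _ (hb.1 j m c hc), fun m c hc => by
      rw [Module.End.mul_apply, Module.End.mul_apply, hb.2 m c hc, ha.2 m _ (hb.1 _ _ c hc)]⟩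
  one_mem' := ⟨fun _ _ _ hc => hc, fun _ _ _ => rfl⟩
  add_mem' := fun ha hb =>
    ⟨fun j m c hc => add_mem (ha.1 j m c hc) (hb.1 j m c hc), fun m c hc => by
      simp [ha.2 m c hc, hb.2 m c hc]⟩
  zero_mem' := ⟨fun _ _ _ _ => zero_mem _, fun _ _ _ => by simp⟩
  neg_mem' := fun ha =>
    ⟨fun j m c hc => neg_mem (ha.1 j m c hc), fun m c hc => by simp [ha.2 m c hc]⟩

theorem boundary_mem_translateLists {V : Set X} {m : ℕ} {c : ListChain X}
    (hc : c ∈ supported ℤ ℤ (translateLists G V (m + 1))) :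
    boundary c ∈ supported ℤ ℤ (translateLists G V m) := by
  refine map_mem_of_single_mem (fun l hl => ?_) hc
  rw [boundary_single]
  refine supported_mono ?_ (faceSum_mem l)
  obtain ⟨hlen, h, hh⟩ := hl
  exact fun l' hl' => ⟨by have := hl'.1; omega, h, fun a ha => hh a (hl'.right ha)⟩

theorem chainAct_mem_preservingCommuting {ι : Type*} (V : ι → Set X) (i : ι) (g : G) :
    chainAct X g ∈
      preservingCommuting (fun j m => supported ℤ ℤ (translateLists G (V j) m)) i := by
  refine ⟨fun j m c hc => ?_, fun m c _ => (boundary_map _ c).symm⟩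
  refine map_mem_of_single_mem (fun l hl => ?_) hc
  rw [chainAct_single]
  obtain ⟨hlen, h, hh⟩ := hl
  refine single_mem_supported _ _ ⟨by simpa using hlen, h * g⁻¹, ?_⟩
  simpa [List.forall_mem_map, mul_smul] using hh

theorem headProj_mem_preservingCommuting {ι : Type*} (V : ι → Set X) (i : ι) {F : Set X}
    (hVF : V i ⊆ F) (hF : ∀ x : X, ∃! h : G, h • x ∈ F) :
    headProj F ∈
      preservingCommuting (fun j m => supported ℤ ℤ (translateLists G (V j) m)) i := by
  classical
  refine ⟨fun j m c hc => ?_, fun m c hc => ?_⟩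
  · refine map_mem_of_single_mem (fun l hl => ?_) hc
    rcases l with _ | ⟨a, l⟩
    · simp [translateLists] at hl
    by_cases ha : a ∈ F
    · rw [headProj_single_of_mem ha]
      exact single_mem_supported _ _ hl
    · rw [headProj_single_of_notMem ha]
      exact zero_mem _
  · suffices H : (headProj F * boundary : Module.End ℤ (ListChain X)) c =
        (boundary * headProj F : Module.End ℤ (ListChain X)) c from H
    refine eq_of_single_eq (fun l hl => ?_) hc
    obtain ⟨hlen, h, hh⟩ := hl
    have hhead : ∀ d ∈ supported ℤ ℤ {l' : List X | l' ≠ [] ∧ l' ⊆ l},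
        headProj F d = (if h = 1 then (1 : Module.End ℤ (ListChain X)) else 0) d := by
      refine fun d hd => eq_of_single_eq (fun l' hl' => ?_) hd
      rcases l' with _ | ⟨a, l'⟩
      · exact absurd rfl hl'.1
      have ha : h • a ∈ V i := hh a (hl'.2 List.mem_cons_self)
      split_ifs with h1
      · rw [h1, one_smul] at ha
        exact headProj_single_of_mem (hVF ha)
      · refine headProj_single_of_notMem fun haF => h1 ?_
        exact (hF a).unique (hVF ha) (by simpa using haF)
    have hbd : boundary (single l 1) ∈ supported ℤ ℤ {l' : List X | l' ≠ [] ∧ l' ⊆ l} := by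
      rw [boundary_single]
      refine supported_mono ?_ (faceSum_mem l)
      refine fun l' hl' => ⟨?_, hl'.2⟩
      have := hl'.1
      rw [← List.length_pos_iff]; omega
    have hsingle : single l (1 : ℤ) ∈ supported ℤ ℤ {l' : List X | l' ≠ [] ∧ l' ⊆ l} :=
      single_mem_supported _ _ ⟨by rw [← List.length_pos_iff]; omega, List.Subset.refl l⟩
    rw [Module.End.mul_apply, Module.End.mul_apply, hhead _ hbd, hhead _ hsingle]
    split_ifs <;> simp

theorem sum_conj_headProj {g : G} (hg : ∀ h : G, h ∈ Subgroup.zpowers g) (hfin : IsOfFinOrder g)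
    {F : Set X} (hF : ∀ x : X, ∃! h : G, h • x ∈ F) {c : ListChain X}
    (hc : c ∈ supported ℤ ℤ {l : List X | l ≠ []}) :
    (∑ i ∈ Finset.range (orderOf g),
      chainAct X g ^ i * headProj F * chainAct X g⁻¹ ^ i) c = c := by
  refine eq_of_single_eq (f' := 1) (fun l hl => ?_) hc
  rcases l with _ | ⟨a, l⟩
  · exact absurd rfl hl
  obtain ⟨h, hh, huniq⟩ := hF a
  have hgi : IsOfFinOrder g⁻¹ := hfin.inv
  obtain ⟨k, hk⟩ : h ∈ Submonoid.powers g⁻¹ := by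
    rw [hgi.mem_powers_iff_mem_zpowers, Subgroup.zpowers_inv]
    exact hg h
  have hpos : 0 < orderOf g := hfin.orderOf_pos
  have hi₀ : g⁻¹ ^ (k % orderOf g) = h := by
    rw [← hk, ← orderOf_inv g, pow_mod_orderOf]
  rw [LinearMap.sum_apply, Finset.sum_eq_single (k % orderOf g)]
  · simp only [Module.End.mul_apply, chainAct_pow, chainAct_single, List.map_cons, hi₀]
    rw [headProj_single_of_mem hh, chainAct_single, ← hi₀]
    simp [Function.comp_def]
  · intro i hi hne
    simp only [Module.End.mul_apply, chainAct_pow, chainAct_single, List.map_cons]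
    rw [headProj_single_of_notMem, LinearMap.map_zero]
    intro hmem
    refine hne ?_
    have h1 := huniq _ hmem
    rw [← hi₀] at h1
    refine pow_injOn_Iio_orderOf (x := g⁻¹) ?_ ?_ h1
    · simpa using hi
    · simpa using Nat.mod_lt _ hpos
  · intro h
    exact absurd (Finset.mem_range.2 (Nat.mod_lt _ hpos)) h

theorem periodicDifferential_zero_apply_nil (g : G) (p : ℕ) (c : ListChain X) :
    periodicDifferential (chainAct X g) p 0 c [] = p * c [] := by
  have hnil : ∀ (h : G) (c : ListChain X), chainAct X h c [] = c [] := by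
    intro h c
    have : lapply [] ∘ₗ chainAct X h = (lapply [] : ListChain X →ₗ[ℤ] ℤ) := by
      refine Finsupp.lhom_ext' fun l => LinearMap.ext_ring ?_
      rcases l with _ | ⟨a, l⟩ <;> simp [chainAct_single]
    exact LinearMap.congr_fun this c
  simp [periodicDifferential, chainAct_pow, hnil]

/-- A free action of a nontrivial finite cyclic group does not admit towers of chains with
arbitrarily fine simplices, relative to a finite family of sets disjoint from their translates. -/
theorem false_of_tower {g : G} (hg : ∀ h : G, h ∈ Subgroup.zpowers g) (hfin : IsOfFinOrder g)
    (hg1 : g ≠ 1) (hfree : ∀ (g : G) (x : X), g • x = x → g = 1)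
    {ι : Type*} [Fintype ι] (V : ι → Set X)
    (hV : ∀ i, ∀ h : G, h ≠ 1 → ∀ x ∈ V i, h • x ∉ V i) (x : ℕ → ListChain X)
    (hx : ∀ k ≤ Fintype.card ι, x k ∈ supported ℤ ℤ (⋃ i, translateLists G (V i) k))
    (hx0 : boundary (x 0) = single [] 1)
    (hDx : ∀ k < Fintype.card ι, boundary (x (k + 1)) =
      periodicDifferential (chainAct X g) (orderOf g) (k + 1) (x k)) : False := by
  classical
  choose F hVF hF using fun i => exists_orbit_section hfree (hV i)
  set T := chainAct X g with hTdef
  set T' := chainAct X g⁻¹ with hTdef'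
  have hTT' : T * T' = 1 := by rw [hTdef, hTdef', chainAct_mul, mul_inv_cancel, chainAct_one]
  have hT'T : T' * T = 1 := by rw [hTdef, hTdef', chainAct_mul, inv_mul_cancel, chainAct_one]
  have hTp : T ^ orderOf g = 1 := by rw [chainAct_pow, pow_orderOf_eq_one, chainAct_one]
  let A : ι → ℕ → Submodule ℤ (ListChain X) :=
    fun i k => supported ℤ ℤ (translateLists G (V i) k)
  let h : ι → ℕ → Module.End ℤ (ListChain X) := fun i k =>
    if Even k then headProj (F i) else cyclicHomotopy T T' (headProj (F i)) (orderOf g)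
  have hmem : ∀ i k, h i k ∈ preservingCommuting A i := by
    intro i k
    have hT := chainAct_mem_preservingCommuting V i g
    have hT' := chainAct_mem_preservingCommuting V i g⁻¹
    have hs := headProj_mem_preservingCommuting V i (hVF i) (hF i)
    simp only [h]
    split_ifs
    · exact hs
    · exact sum_mem fun j _ => mul_mem (mul_mem (pow_mem hT _) hs)
        (sub_mem (sum_mem fun j _ => pow_mem hT' _) (one_mem _))
  have hid : ∀ i k j m, ∀ c ∈ A j m, h i (k + 1) (periodicDifferential T (orderOf g) (k + 1) c)
      + periodicDifferential T (orderOf g) k (h i k c) = c := by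
    intro i k j m c hc
    have hc' : c ∈ supported ℤ ℤ {l : List X | l ≠ []} := by
      refine supported_mono ?_ hc
      exact fun l hl => List.ne_nil_of_length_eq_add_one hl.1
    have hJ := sum_conj_headProj hg hfin (hF i) hc'
    by_cases hk : Even k
    · rw [← cyclicHomotopy_mul _ _ hT'T] at hJ
      simpa [h, periodicDifferential, hk, Nat.even_add_one, add_comm] using hJ
    · rw [← mul_cyclicHomotopy _ hTT' hTp] at hJ
      simpa [h, periodicDifferential, hk, Nat.even_add_one] using hJ
  obtain ⟨z, w, hzw⟩ := exists_eq_boundary_add_of_tower boundary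
    (periodicDifferential T (orderOf g)) h A boundary_boundary
    (boundary_periodicDifferential g _) (periodicDifferential_succ_apply g)
    hid (fun i k => (hmem i k).1) (fun j m c hc => boundary_mem_translateLists hc)
    (fun i k => (hmem i k).2) Finset.univ x
    (fun k hk => by
      have := hx k hk
      rw [supported_iUnion] at this
      simpa [A] using this)
    (by simpa using hDx)
  have hfinal := congrArg (fun c : ListChain X => c []) hx0
  simp only [hzw, map_add, boundary_boundary, zero_add, single_eq_same] at hfinal
  rw [boundary_periodicDifferential, periodicDifferential_zero_apply_nil] at hfinal
  have hunit := Int.isUnit_iff.1 (IsUnit.of_mul_eq_one _ hfinal)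
  have hne : orderOf g ≠ 1 := fun h => hg1 (orderOf_eq_one_iff.1 h)
  omega

end Action

section Euclidean

open ListChain Finsupp

/-- A finite group acting continuously moves balls into balls, uniformly continuously. -/
theorem exists_bound_and_modulus {G E : Type*} [Group G] [Finite G] [NormedAddCommGroup E]
    [ProperSpace E] [MulAction G E] (hcont : ∀ g : G, Continuous fun x : E => g • x) (R : ℝ) :
    ∃ R' : ℝ, (∀ g : G, ∀ a : E, ‖a‖ ≤ R → ‖g • a‖ ≤ R') ∧
      ∀ ε > 0, ∃ δ > 0, ∀ g : G, ∀ a b : E, ‖a‖ ≤ R → ‖b‖ ≤ R → dist a b < δ →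
        dist (g • a) (g • b) < ε := by
  have hK : IsCompact (Metric.closedBall (0 : E) R) := isCompact_closedBall 0 R
  have hbound : ∀ g : G, ∃ r : ℝ, ∀ a : E, ‖a‖ ≤ R → ‖g • a‖ ≤ r := fun g => by
    obtain ⟨r, hr⟩ := hK.exists_bound_of_continuousOn (hcont g).continuousOn
    exact ⟨r, fun a ha => hr a (by simpa using ha)⟩
  choose r hr using hbound
  obtain ⟨R', hR'⟩ := (Set.finite_range r).bddAbove
  refine ⟨R', fun g a ha => (hr g a ha).trans (hR' ⟨g, rfl⟩), fun ε hε => ?_⟩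
  have hmod : ∀ g : G, ∃ δ > 0, ∀ a b : E, ‖a‖ ≤ R → ‖b‖ ≤ R → dist a b < δ →
      dist (g • a) (g • b) < ε := fun g => by
    obtain ⟨δ, hδ, h⟩ := Metric.uniformContinuousOn_iff.1
      (hK.uniformContinuousOn_of_continuous (hcont g).continuousOn) ε hε
    exact ⟨δ, hδ, fun a b ha hb hab => h a (by simpa using ha) b (by simpa using hb) hab⟩
  choose δ hδ h using hmod
  obtain ⟨g₀, hg₀⟩ := Finite.exists_min δ
  exact ⟨δ g₀, hδ g₀, fun g a b ha hb hab => h g a b ha hb (hab.trans_le (hg₀ g))⟩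

/-- The start of a free resolution of the trivial module, realised by chains with arbitrarily
small simplices in a fixed ball. -/
theorem exists_small_tower {G E : Type*} [Group G] [Finite G] [NormedAddCommGroup E]
    [NormedSpace ℝ E] [ProperSpace E] [MulAction G E]
    (hcont : ∀ g : G, Continuous fun x : E => g • x) (g : G) (K : ℕ) :
    ∃ R : ℝ, 0 ≤ R ∧ ∀ ε > 0, ∃ x : ℕ → ListChain E,
      (∀ k ≤ K, x k ∈ supported ℤ ℤ (smallLists E k R ε)) ∧ boundary (x 0) = single [] 1 ∧
      ∀ k < K, boundary (x (k + 1)) =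
        periodicDifferential (chainAct E g) (orderOf g) (k + 1) (x k) := by
  induction K with
  | zero =>
    refine ⟨0, le_rfl, fun ε hε => ⟨fun _ => single [0] 1, ?_, ?_, by simp⟩⟩
    · rintro k hk
      obtain rfl : k = 0 := by omega
      exact single_mem_supported _ _ ⟨rfl, by simp, by simpa using hε⟩
    · simp [boundary_single, faceSum]
  | succ K ih =>
    obtain ⟨R, hR, hx⟩ := ih
    obtain ⟨R', hR', hmod⟩ := exists_bound_and_modulus hcont R
    have hRR' : ∀ a : E, ‖a‖ ≤ R → ‖a‖ ≤ max R' 0 := fun a ha =>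
      le_max_of_le_left (by simpa using hR' 1 a ha)
    refine ⟨max R' 0, le_max_right _ _, fun ε hε => ?_⟩
    obtain ⟨δ, hδ, hmodδ⟩ := hmod (ε / 2) (half_pos hε)
    obtain ⟨x, hxs, hx0, hDx⟩ := hx (min δ ε) (lt_min hδ hε)
    set θ := periodicDifferential (chainAct E g) (orderOf g)
    have hact : ∀ h : G, chainAct E h (x K) ∈
        supported ℤ ℤ (smallLists E K (max R' 0) (ε / 2)) := by
      refine fun h => map_mem_of_single_mem (fun l hl => ?_) (hxs K le_rfl)
      rw [chainAct_single]
      refine single_mem_supported _ _ ⟨by simp [hl.1], ?_, ?_⟩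
      · simp only [List.forall_mem_map]
        exact fun a ha => le_max_of_le_left (hR' h a (hl.2.1 a ha))
      · simp only [List.forall_mem_map]
        exact fun a ha b hb => hmodδ h a b (hl.2.1 a ha) (hl.2.1 b hb)
          ((hl.2.2 a ha b hb).trans_le (min_le_left _ _))
    have hθ : θ (K + 1) (x K) ∈ supported ℤ ℤ (smallLists E K (max R' 0) (ε / 2)) := by
      simp only [θ, periodicDifferential]
      split_ifs
      · rw [LinearMap.sum_apply]
        refine sum_mem fun i _ => ?_
        rw [chainAct_pow]
        exact hact _
      · refine sub_mem ?_ (hact g)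
        simpa [chainAct_one] using hact 1
    have hcycle : boundary (θ (K + 1) (x K)) = 0 := by
      rw [boundary_periodicDifferential]
      rcases K with _ | K
      · rw [hx0]
        simp [periodicDifferential, chainAct_single]
      · rw [hDx K (Nat.lt_succ_self K)]
        exact periodicDifferential_succ_apply g _ _
    obtain ⟨y, hy, hDy⟩ := exists_boundary_eq_of_small (le_max_right _ _) (half_pos hε) hθ hcycle
    rw [mul_div_cancel₀ ε two_ne_zero] at hy
    refine ⟨Function.update x (K + 1) y, fun k hk => ?_, ?_, fun k hk => ?_⟩
    · rcases Nat.lt_succ_iff_lt_or_eq.1 (Nat.lt_succ_of_le hk) with hlt | rfl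
      · rw [Function.update_of_ne hlt.ne]
        refine supported_mono ?_ (hxs k (Nat.le_of_lt_succ hlt))
        exact fun l hl => ⟨hl.1, fun a ha => hRR' a (hl.2.1 a ha), fun a ha b hb =>
          (hl.2.2 a ha b hb).trans_le (min_le_right _ _)⟩
      · rwa [Function.update_self]
    · rwa [Function.update_of_ne (Nat.succ_ne_zero K).symm]
    · rcases Nat.lt_succ_iff_lt_or_eq.1 hk with hlt | rfl
      · rw [Function.update_of_ne (by omega), Function.update_of_ne (by omega)]
        exact hDx k hlt
      · rwa [Function.update_self, Function.update_of_ne (by omega)]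

/-- The points whose orbit attains its larger `j`-th coordinates exactly along `A`. -/
def peakSet {G : Type*} [Group G] {n : ℕ} [MulAction G (EuclideanSpace ℝ (Fin n))]
    (j : Fin n) (A : Set G) : Set (EuclideanSpace ℝ (Fin n)) :=
  {x | (A.Nonempty ∧ A ≠ Set.univ) ∧ ∀ a ∈ A, ∀ b ∈ Aᶜ, (b • x) j < (a • x) j}

section PeakSet

variable {G : Type*} [Group G] {n : ℕ} [MulAction G (EuclideanSpace ℝ (Fin n))]

theorem isOpen_peakSet [Finite G]
    (hcont : ∀ g : G, Continuous fun x : EuclideanSpace ℝ (Fin n) => g • x)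
    (j : Fin n) (A : Set G) : IsOpen (peakSet j A) := by
  have hj : ∀ g : G, Continuous fun x : EuclideanSpace ℝ (Fin n) => (g • x) j := fun g =>
    (EuclideanSpace.proj (𝕜 := ℝ) j).continuous.comp (hcont g)
  refine isOpen_const.and ?_
  have : {x : EuclideanSpace ℝ (Fin n) | ∀ a ∈ A, ∀ b ∈ Aᶜ, (b • x) j < (a • x) j} =
      ⋂ a ∈ A, ⋂ b ∈ Aᶜ, {x | (b • x) j < (a • x) j} := by
    ext x; simp
  rw [this]
  exact (Set.toFinite A).isOpen_biInter fun a _ =>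
    (Set.toFinite Aᶜ).isOpen_biInter fun b _ => isOpen_lt (hj b) (hj a)

theorem exists_mem_peakSet [Finite G] {g : G} {x : EuclideanSpace ℝ (Fin n)} (hx : g • x ≠ x) :
    ∃ j A, x ∈ peakSet (G := G) j A := by
  obtain ⟨j, hj⟩ : ∃ j, (g • x) j ≠ x j := by
    by_contra! h
    exact hx (PiLp.ext h)
  obtain ⟨m, hm⟩ := Finite.exists_max fun a : G => (a • x) j
  refine ⟨j, {a | (a • x) j = (m • x) j}, ⟨⟨m, rfl⟩, fun h => hj ?_⟩, fun a ha b hb => ?_⟩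
  · have h1 : (g • x) j = (m • x) j := Set.ext_iff.1 h g |>.2 trivial
    have h2 : ((1 : G) • x) j = (m • x) j := Set.ext_iff.1 h 1 |>.2 trivial
    rw [h1, ← h2, one_smul]
  · rw [show (a • x) j = (m • x) j from ha]
    exact lt_of_le_of_ne (hm b) hb

/-- For a group of prime order the peak sets are disjoint from their translates. -/
theorem smul_notMem_peakSet (hG : (Nat.card G).Prime) (j : Fin n) (A : Set G) {h : G}
    (h1 : h ≠ 1) {x : EuclideanSpace ℝ (Fin n)} (hx : x ∈ peakSet (G := G) j A) :
    h • x ∉ peakSet (G := G) j A := by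
  intro hhx
  have : Finite G := Nat.finite_of_card_ne_zero hG.ne_zero
  have : Fact (Nat.card G).Prime := ⟨hG⟩
  let B : Set G := (· * h) '' A
  have hcard : B.ncard = A.ncard := Set.ncard_image_of_injective _ (mul_left_injective h)
  have hnest : A ⊆ B ∨ B ⊆ A := by
    by_contra! hcon
    obtain ⟨⟨a, ha, haB⟩, ⟨_, ⟨b, hb, rfl⟩, hbA⟩⟩ :=
      hcon.imp Set.not_subset.1 Set.not_subset.1
    have h2 := hx.2 a ha _ hbA
    have h3 := hhx.2 b hb (a * h⁻¹) fun hmem => haB ⟨_, hmem, by simp⟩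
    rw [← mul_smul, ← mul_smul, inv_mul_cancel_right] at h3
    exact lt_asymm h2 h3
  have hBA : B = A := by
    rcases hnest with hs | hs
    · exact (Set.eq_of_subset_of_ncard_le hs hcard.le).symm
    · exact Set.eq_of_subset_of_ncard_le hs hcard.ge
  have hstep : ∀ a ∈ A, a * h ∈ A := fun a ha => hBA ▸ (⟨a, ha, rfl⟩ : a * h ∈ B)
  have hpow : ∀ (k : ℕ), ∀ a ∈ A, a * h ^ k ∈ A := by
    intro k
    induction k with
    | zero => simp
    | succ k ih =>
      intro a ha
      rw [pow_succ, ← mul_assoc]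
      exact hstep _ (ih a ha)
  obtain ⟨a, ha⟩ := hx.1.1
  refine hx.1.2 (Set.eq_univ_of_forall fun b => ?_)
  obtain ⟨k, hk⟩ := mem_powers_of_prime_card rfl h1 (g' := a⁻¹ * b)
  have := hpow k a ha
  rwa [show h ^ k = a⁻¹ * b from hk, mul_inv_cancel_left] at this

end PeakSet

/-- A group of prime order does not act freely and continuously on a Euclidean space. -/
theorem not_free_of_prime_card {G : Type*} [Group G] (hG : (Nat.card G).Prime) {n : ℕ}
    [MulAction G (EuclideanSpace ℝ (Fin n))]
    (hcont : ∀ g : G, Continuous fun x : EuclideanSpace ℝ (Fin n) => g • x) :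
    ¬ ∀ (g : G) (x : EuclideanSpace ℝ (Fin n)), g • x = x → g = 1 := by
  intro hfree
  have : Finite G := Nat.finite_of_card_ne_zero hG.ne_zero
  have : Fact (Nat.card G).Prime := ⟨hG⟩
  have : Nontrivial G := Finite.one_lt_card_iff_nontrivial.1 hG.one_lt
  have : Fintype (Fin n × Set G) := Fintype.ofFinite _
  obtain ⟨g, hg1⟩ := exists_ne (1 : G)
  let V : Fin n × Set G → Set (EuclideanSpace ℝ (Fin n)) := fun i => peakSet i.1 i.2
  obtain ⟨R, hR, hx⟩ := exists_small_tower hcont g (Fintype.card (Fin n × Set G))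
  obtain ⟨δ, hδ, hball⟩ := lebesgue_number_lemma_of_metric
    (isCompact_closedBall (0 : EuclideanSpace ℝ (Fin n)) R)
    (fun i => isOpen_peakSet hcont i.1 i.2 : ∀ i, IsOpen (V i)) (fun x _ => by
      obtain ⟨j, A, h⟩ := exists_mem_peakSet fun h => hg1 (hfree g x h)
      exact Set.mem_iUnion.2 ⟨(j, A), h⟩)
  obtain ⟨x, hxs, hx0, hDx⟩ := hx δ hδ
  refine false_of_tower (fun h => mem_zpowers_of_prime_card rfl hg1) (isOfFinOrder_of_finite g)
    hg1 hfree V (fun i h h1 y hy => smul_notMem_peakSet hG i.1 i.2 h1 hy) x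
    (fun k hk => ?_) hx0 hDx
  refine supported_mono ?_ (hxs k hk)
  rintro l ⟨hlen, hnorm, hdist⟩
  obtain ⟨a, ha⟩ := List.exists_mem_of_length_eq_add_one hlen
  obtain ⟨i, hi⟩ := hball a (by simpa using hnorm a ha)
  refine Set.mem_iUnion.2 ⟨i, hlen, 1, fun b hb => ?_⟩
  rw [one_smul]
  exact hi (hdist b hb a ha)

end Euclidean

/-- If a group `G` acts on `ℝⁿ` by homeomorphisms, continuously, freely and
properly discontinuously, then `G` is torsion-free: every nontrivial element
has infinite order. -/
theorem torsionFree_of_free_properlyDiscontinuous_action (n : ℕ) (G : Type*) [Group G]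
    [MulAction G (EuclideanSpace ℝ (Fin n))]
    (hcont : ∀ g : G, Continuous fun x : EuclideanSpace ℝ (Fin n) => g • x)
    (hfree : ∀ (g : G) (x : EuclideanSpace ℝ (Fin n)), g • x = x → g = 1)
    (hpd : ∀ K L : Set (EuclideanSpace ℝ (Fin n)), IsCompact K → IsCompact L →
      {g : G | (g • K) ∩ L ≠ ∅}.Finite) :
    ∀ g : G, g ≠ 1 → ¬ IsOfFinOrder g := by
  intro g hg hfin
  have hord : orderOf g ≠ 1 := fun h => hg (orderOf_eq_one_iff.1 h)
  have hp := Nat.minFac_prime hord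
  set p := (orderOf g).minFac
  let g' := g ^ (orderOf g / p)
  have hg' : orderOf g' = p := orderOf_pow_orderOf_div hfin.orderOf_pos.ne' (Nat.minFac_dvd _)
  refine not_free_of_prime_card (G := Subgroup.zpowers g') (n := n) ?_ (fun h => hcont h)
    fun h x hx => Subtype.ext (hfree h x hx)
  rwa [Nat.card_zpowers, hg']
end

section
/- Let n and k be natural numbers and suppose the group ℤᵏ acts on Euclidean space ℝⁿ by homeomorphisms, the action being continuous, free, and properly discontinuous. If the orbit space ℝⁿ/ℤᵏ is not compact, then k < n. -/
open Pointwise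

open Metric Set Filter Topology MeasureTheory

open Polynomial in
/-- Evaluation at `1` of a polynomial of bounded degree is a fixed linear combination of its values
at points of `(0, ε)`. -/
theorem exists_weights_eval_one (d : ℕ) {ε : ℝ} (hε : 0 < ε) :
    ∃ (s : Finset ℝ) (w : ℝ → ℝ), (∀ t ∈ s, 0 < t ∧ t < ε) ∧
      ∀ p : ℝ[X], p.natDegree ≤ d → p.eval 1 = ∑ t ∈ s, w t * p.eval t := by
  obtain ⟨s, hs, hcard⟩ := (Ioo_infinite hε).exists_subset_card_eq (d + 1)
  refine ⟨s, fun t => (Lagrange.basis s id t).eval 1, fun t ht => hs ht, fun p hp => ?_⟩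
  have hdeg : p.degree < s.card := by
    rw [hcard]
    exact Polynomial.degree_le_natDegree.trans_lt (by exact_mod_cast Nat.lt_succ_of_le hp)
  conv_lhs => rw [Lagrange.eq_interpolate (injOn_id _) hdeg]
  simp [Lagrange.interpolate_apply, Polynomial.eval_finsetSum, mul_comm]

section Finite

variable {E : Type*} [NormedAddCommGroup E] [InnerProductSpace ℝ E]

/-- A map vanishing on the bounding sphere of a ball and Lipschitz on it stays Lipschitz when
extended by zero. -/
theorem lipschitzWith_indicator_closedBall {v : E → E} {R : ℝ} {K : NNReal}
    (hK : LipschitzOnWith K v (closedBall 0 R)) (hv : ∀ x, ‖x‖ = R → v x = 0) :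
    LipschitzWith K ((closedBall 0 R).indicator v) := by
  have key : ∀ x y : E, x ∈ closedBall (0 : E) R → y ∉ closedBall (0 : E) R →
      ‖v x‖ ≤ K * ‖x - y‖ := by
    intro x y hx hy
    rw [mem_closedBall_zero_iff] at hx hy
    obtain ⟨z, hz, hzR⟩ : ∃ z ∈ segment ℝ x y, ‖z‖ = R :=
      (convex_segment x y).isPreconnected.intermediate_value (left_mem_segment ℝ x y)
        (right_mem_segment ℝ x y) continuous_norm.continuousOn ⟨hx, (not_le.mp hy).le⟩
    have h := hK.dist_le_mul x (by simpa using hx) z (by simp [hzR])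
    rw [hv z hzR, dist_zero_right] at h
    refine h.trans (mul_le_mul_of_nonneg_left ?_ K.2)
    have := dist_add_dist_of_mem_segment hz
    rw [← dist_eq_norm]
    linarith [dist_nonneg (x := z) (y := y)]
  refine LipschitzWith.of_dist_le_mul fun x y => ?_
  by_cases hx : x ∈ closedBall (0 : E) R <;> by_cases hy : y ∈ closedBall (0 : E) R
  · simpa [indicator_of_mem hx, indicator_of_mem hy] using hK.dist_le_mul x hx y hy
  · simpa [indicator_of_mem hx, indicator_of_notMem hy, dist_eq_norm] using key x y hx hy
  · rw [dist_comm, dist_comm x]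
    simpa [indicator_of_notMem hx, indicator_of_mem hy, dist_eq_norm] using key y x hy hx
  · simp [indicator_of_notMem hx, indicator_of_notMem hy]
    positivity

variable [FiniteDimensional ℝ E]

/-- A small Lipschitz perturbation of the identity which is trivial outside a set is injective and
maps the set onto itself. -/
theorem injective_and_image_eq_of_lipschitzWith {w : E → E} {K : NNReal} (hw : LipschitzWith K w)
    (hK : K < 1) {s : Set E} (hs : ∀ x, x ∉ s → w x = 0) :
    Function.Injective (fun x => x + w x) ∧ (fun x => x + w x) '' s = s := by
  have hinj : Function.Injective (fun x => x + w x) := by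
    intro x y (hxy : x + w x = y + w y)
    have h1 : x - y = w y - w x := by
      rw [sub_eq_sub_iff_add_eq_add, hxy, add_comm]
    have h2 := hw.dist_le_mul y x
    rw [dist_eq_norm, ← h1, dist_comm, dist_eq_norm] at h2
    have h3 : (K : ℝ) < 1 := hK
    have h4 : ‖x - y‖ = 0 := by nlinarith [norm_nonneg (x - y)]
    exact sub_eq_zero.mp (norm_eq_zero.mp h4)
  refine ⟨hinj, Subset.antisymm ?_ fun y hy => ?_⟩
  · rintro _ ⟨x, hx, rfl⟩
    by_contra hn
    have h : x + w x = x := hinj (by simp [hs _ hn])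
    simp only [h] at hn
    exact hn hx
  · have hc : ContractingWith K (fun x => y - w x) := by
      refine ⟨hK, LipschitzWith.of_dist_le_mul fun a b => ?_⟩
      rw [dist_sub_left]
      exact hw.dist_le_mul a b
    obtain ⟨x, hx, -⟩ := hc.exists_fixedPoint y (edist_ne_top _ _)
    have hx' : x + w x = y := by
      exact (sub_eq_iff_eq_add.mp hx).symm
    refine ⟨x, ?_, hx'⟩
    by_contra hn
    rw [hs x hn, add_zero] at hx'
    exact hn (hx' ▸ hy)

open Polynomial in
theorem exists_polynomial_eval_eq_det_one_add_smul (A : E →L[ℝ] E) :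
    ∃ p : ℝ[X], p.natDegree ≤ Module.finrank ℝ E ∧
      ∀ t : ℝ, p.eval t = (1 + t • A : E →L[ℝ] E).det := by
  let b := Module.finBasis ℝ E
  let M := LinearMap.toMatrix b b (A : E →ₗ[ℝ] E)
  refine ⟨((X : ℝ[X]) • M.map C + (1 : Matrix _ _ ℝ).map C).det, ?_, fun t => ?_⟩
  · simpa using natDegree_det_X_add_C_le M 1
  · have h : (1 + t • A : E →L[ℝ] E).det = LinearMap.det (1 + t • (A : E →ₗ[ℝ] E)) := rfl
    rw [h, ← LinearMap.det_toMatrix b, ← Polynomial.coe_evalRingHom, RingHom.map_det]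
    congr 1
    ext i j
    by_cases hij : i = j
    · subst hij
      simpa [M, LinearMap.toMatrix_one, add_comm] using mul_comm _ _
    · simpa [M, LinearMap.toMatrix_one, hij] using mul_comm _ _

/-- A continuous self-map without zeros at bounded distance from the identity yields a smooth
retraction onto a sphere. -/
theorem exists_contDiff_retraction_of_ne_zero {H : E → E} (hH : Continuous H) {C : ℝ}
    (hC : ∀ x, ‖H x - x‖ ≤ C) (h0 : ∀ x, H x ≠ 0) :
    ∃ R > 0, ∃ r : E → E, ContDiff ℝ 1 r ∧ (∀ x, ‖r x‖ = R) ∧ ∀ x, ‖x‖ = R → r x = x := by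
  obtain ⟨G, hG, hGd, -⟩ := hH.exists_contDiff_approx 1 (ε := fun x => min 1 ‖H x‖)
    (by fun_prop) (fun x => lt_min one_pos (norm_pos_iff.mpr (h0 x)))
  have hG0 : ∀ x, G x ≠ 0 := by
    intro x hx
    have := (hGd x).trans_le (min_le_right _ _)
    rw [hx, dist_zero_left] at this
    exact this.false
  have hGC : ∀ x, ‖G x - x‖ ≤ C + 1 := by
    intro x
    have h1 := (hGd x).trans_le (min_le_left _ _)
    rw [dist_eq_norm] at h1
    have h2 := norm_sub_le_norm_sub_add_norm_sub (G x) (H x) x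
    linarith [hC x]
  have hC1 : 0 < C + 2 := by linarith [(norm_nonneg _).trans (hC 0)]
  let χ : ContDiffBump (0 : E) := ⟨C + 2, C + 3, hC1, by linarith⟩
  let P : E → E := fun x => x + χ x • (G x - x)
  have hP : ContDiff ℝ 1 P := contDiff_id.add (χ.contDiff.smul (hG.sub contDiff_id))
  have hP0 : ∀ x, P x ≠ 0 := by
    intro x hx
    by_cases hxC : ‖x‖ ≤ C + 2
    · have h1 : χ x = 1 := χ.one_of_mem_closedBall (by simpa using hxC)
      simp only [P, h1, one_smul, add_sub_cancel] at hx
      exact hG0 x hx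
    · have h1 : x = -(χ x • (G x - x)) := eq_neg_of_add_eq_zero_left hx
      have h2 : ‖x‖ ≤ C + 1 := by
        conv_lhs => rw [h1]
        rw [norm_neg, norm_smul, Real.norm_of_nonneg χ.nonneg]
        exact (mul_le_of_le_one_left (norm_nonneg _) χ.le_one).trans (hGC x)
      linarith
  refine ⟨C + 3, by linarith, fun x => ((C + 3) * ‖P x‖⁻¹) • P x, ?_, fun x => ?_, fun x hx => ?_⟩
  · exact (contDiff_const.mul ((hP.norm ℝ hP0).inv fun x => norm_ne_zero_iff.mpr (hP0 x))).smul hP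
  · rw [norm_smul, norm_mul, norm_inv, norm_norm, mul_assoc,
      inv_mul_cancel₀ (norm_ne_zero_iff.mpr (hP0 x)), mul_one, Real.norm_of_nonneg (by linarith)]
  · have h1 : χ x = 0 := χ.zero_of_le_dist (by simp [hx, χ])
    have hPx : P x = x := by simp [P, h1]
    simp only [hPx, hx]
    rw [mul_inv_cancel₀ (by linarith), one_smul]

theorem det_fderiv_eq_zero_of_norm_eq {r : E → E} (hr : Differentiable ℝ r) {R : ℝ} (hR : 0 < R)
    (h : ∀ x, ‖r x‖ = R) (x : E) : (fderiv ℝ r x).det = 0 := by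
  have hort : ∀ y, inner ℝ (r x) (fderiv ℝ r x y) = 0 := by
    intro y
    have h1 := (hr x).hasFDerivAt.norm_sq
    have h2 : HasFDerivAt (fun z => ‖r z‖ ^ 2) (0 : E →L[ℝ] ℝ) x := by
      simp_rw [h]
      exact hasFDerivAt_const _ _
    have h3 := congrArg (fun L : E →L[ℝ] ℝ => L y) (h1.unique h2)
    simpa using h3
  by_contra hdet
  obtain ⟨y, hy⟩ : ∃ y, fderiv ℝ r x y = r x :=
    ((LinearMap.equivOfDetNeZero _ hdet).surjective) (r x)
  have := hort y
  rw [hy, real_inner_self_eq_norm_sq, h x] at this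
  exact hR.ne' (pow_eq_zero_iff two_ne_zero |>.mp this)

variable [MeasurableSpace E] [BorelSpace E]

theorem exists_integral_det_one_add_smul_eq {v : E → E} (hv : ContDiff ℝ 1 v) {R : ℝ}
    (hv0 : ∀ x, ‖x‖ = R → v x = 0) :
    ∃ ε > 0, ∀ t : ℝ, 0 < t → t < ε →
      ∫ x in closedBall (0 : E) R, (1 + t • fderiv ℝ v x : E →L[ℝ] E).det =
        volume.real (closedBall (0 : E) R) := by
  obtain ⟨K, hK⟩ := hv.contDiffOn.exists_lipschitzOnWith (s := closedBall (0 : E) R) one_ne_zero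
    (convex_closedBall _ _) (isCompact_closedBall _ _)
  have hcont : Continuous (fderiv ℝ v) := hv.continuous_fderiv one_ne_zero
  obtain ⟨M, hM⟩ := (isCompact_closedBall (0 : E) R).exists_bound_of_continuousOn
    hcont.continuousOn
  obtain ⟨δ, hδ, hdet⟩ : ∃ δ > 0, ∀ B : E →L[ℝ] E, ‖B‖ < δ → 0 < (1 + B).det := by
    have h1 : ContinuousAt (fun B : E →L[ℝ] E => (1 + B).det) 0 :=
      (ContinuousLinearMap.continuous_det.comp (continuous_const.add continuous_id)).continuousAt
    have h2 : (0 : ℝ) < (1 + 0 : E →L[ℝ] E).det := by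
      simp [ContinuousLinearMap.det]
    obtain ⟨δ, hδ, h⟩ := Metric.eventually_nhds_iff.mp (h1.eventually (lt_mem_nhds h2))
    exact ⟨δ, hδ, fun B hB => h (by simpa using hB)⟩
  refine ⟨min (1 / (K + 1)) (δ / (|M| + 1)), by positivity, fun t ht htε => ?_⟩
  obtain ⟨ht1, ht2⟩ := lt_min_iff.mp htε
  rw [lt_div_iff₀ (by positivity)] at ht1 ht2
  have hpos : ∀ x ∈ closedBall (0 : E) R, 0 < (1 + t • fderiv ℝ v x : E →L[ℝ] E).det := by
    intro x hx
    refine hdet _ ?_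
    rw [norm_smul, Real.norm_of_nonneg ht.le]
    nlinarith [hM x hx, le_abs_self M]
  have hw : LipschitzWith (t.toNNReal * K) (t • (closedBall (0 : E) R).indicator v) := by
    have := lipschitzWith_indicator_closedBall hK hv0
    refine LipschitzWith.of_dist_le_mul fun x y => ?_
    simp only [Pi.smul_apply, dist_smul₀, NNReal.coe_mul, Real.coe_toNNReal _ ht.le,
      Real.norm_of_nonneg ht.le, mul_assoc]
    exact mul_le_mul_of_nonneg_left (this.dist_le_mul x y) ht.le
  have hlt : t.toNNReal * K < 1 := by
    rw [← NNReal.coe_lt_coe]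
    simp only [NNReal.coe_mul, Real.coe_toNNReal _ ht.le, NNReal.coe_one]
    linarith
  obtain ⟨hinj, himg⟩ := injective_and_image_eq_of_lipschitzWith hw hlt
    (s := closedBall (0 : E) R) (fun x hx => by simp [indicator_of_notMem hx])
  have heq : EqOn (fun x => x + (t • (closedBall (0 : E) R).indicator v) x)
      (fun x => x + t • v x) (closedBall 0 R) := fun x hx => by
    simp [indicator_of_mem hx]
  have hinj' : InjOn (fun x => x + t • v x) (closedBall (0 : E) R) := hinj.injOn.congr heq
  rw [heq.image_eq] at himg
  have hder : ∀ x ∈ closedBall (0 : E) R, HasFDerivWithinAt (fun x => x + t • v x)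
      (1 + t • fderiv ℝ v x : E →L[ℝ] E) (closedBall 0 R) x := fun x _ =>
    ((hasFDerivAt_id x).add
      (((hv.differentiable one_ne_zero) x).hasFDerivAt.const_smul t)).hasFDerivWithinAt
  have h := integral_image_eq_integral_abs_det_fderiv_smul volume measurableSet_closedBall hder
    hinj' (fun _ => (1 : ℝ))
  rw [himg] at h
  simp only [integral_const, MeasurableSet.univ, measureReal_restrict_apply, univ_inter,
    smul_eq_mul, mul_one] at h
  rw [h]
  refine setIntegral_congr_fun measurableSet_closedBall fun x hx => ?_
  simp only [abs_of_pos (hpos x hx)]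

/-- The Jacobian of a `C¹` self-map of a vector space which fixes a sphere pointwise integrates to
the volume of the enclosed ball. -/
theorem integral_det_one_add_fderiv {v : E → E} (hv : ContDiff ℝ 1 v) {R : ℝ}
    (hv0 : ∀ x, ‖x‖ = R → v x = 0) :
    ∫ x in closedBall (0 : E) R, (1 + fderiv ℝ v x : E →L[ℝ] E).det =
      volume.real (closedBall (0 : E) R) := by
  obtain ⟨ε, hε, h⟩ := exists_integral_det_one_add_smul_eq hv hv0
  obtain ⟨s, w, hs, hw⟩ := exists_weights_eval_one (Module.finrank ℝ E) hε
  have hsum : ∑ t ∈ s, w t = 1 := by simpa using (hw 1 (by simp)).symm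
  have hpt : ∀ x : E, (1 + fderiv ℝ v x : E →L[ℝ] E).det =
      ∑ t ∈ s, w t * (1 + t • fderiv ℝ v x : E →L[ℝ] E).det := by
    intro x
    obtain ⟨p, hp, hpe⟩ := exists_polynomial_eval_eq_det_one_add_smul (fderiv ℝ v x)
    simpa [hpe] using hw p hp
  have hcont : ∀ t : ℝ, Continuous fun x => (1 + t • fderiv ℝ v x : E →L[ℝ] E).det := fun t =>
    ContinuousLinearMap.continuous_det.comp
      (continuous_const.add ((hv.continuous_fderiv one_ne_zero).const_smul t))
  simp_rw [hpt]
  rw [integral_finsetSum]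
  · simp_rw [integral_const_mul]
    rw [Finset.sum_congr rfl fun t ht => by rw [h t (hs t ht).1 (hs t ht).2], ← Finset.sum_mul,
      hsum, one_mul]
  · intro t _
    exact ((hcont t).const_mul _).continuousOn.integrableOn_compact (isCompact_closedBall _ _)

/-- A continuous self-map of a Euclidean space at bounded distance from the identity is surjective
(a form of Brouwer's fixed point theorem). -/
theorem surjective_of_norm_sub_id_le {H : E → E} (hH : Continuous H) {C : ℝ}
    (hC : ∀ x, ‖H x - x‖ ≤ C) : Function.Surjective H := by
  intro c
  by_contra! hc
  obtain ⟨R, hR, r, hr, hrR, hfix⟩ := exists_contDiff_retraction_of_ne_zero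
    (H := fun x => H x - c) (by fun_prop) (C := C + ‖c‖)
    (fun x => by
      rw [sub_right_comm]
      exact (norm_sub_le _ _).trans (by linarith [hC x]))
    (fun x => sub_ne_zero.mpr (hc x))
  have hd := hr.differentiable one_ne_zero
  have h := integral_det_one_add_fderiv (hr.sub contDiff_id) (R := R)
    (fun x hx => by simp [hfix x hx])
  have hz : ∀ x, (1 + fderiv ℝ (fun y => r y - id y) x : E →L[ℝ] E).det = 0 := by
    intro x
    rw [fderiv_fun_sub (hd x) differentiableAt_id, fderiv_id]
    exact (congrArg ContinuousLinearMap.det (add_sub_cancel _ _)).trans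
      (det_fderiv_eq_zero_of_norm_eq hd hR hrR x)
  simp only [hz, integral_zero] at h
  have hpos : 0 < volume.real (closedBall (0 : E) R) :=
    ENNReal.toReal_pos (measure_closedBall_pos _ _ hR).ne' measure_closedBall_lt_top.ne
  exact hpos.ne h

/-- A continuous proper self-map of a Euclidean space with a smooth coarse left inverse is
surjective. -/
theorem surjective_of_coarse_left_inverse {f g : E → E} (hf : Continuous f)
    (hproper : ∀ Q, IsCompact Q → Bornology.IsBounded (f ⁻¹' Q)) (hg : ContDiff ℝ 1 g) {C : ℝ}
    (hgf : ∀ x, ‖g (f x) - x‖ ≤ C) : Function.Surjective f := by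
  intro p
  by_contra! hp
  have : Nontrivial E := ⟨f p, p, hp p⟩
  obtain ⟨R, hR, hRsub⟩ : ∃ R > 0, f '' closedBall 0 (C + 1) ⊆ ball p R := by
    obtain ⟨R, hR⟩ := ((isCompact_closedBall (0 : E) (C + 1)).image hf).isBounded.subset_ball p
    exact ⟨max R 1, by positivity, hR.trans (ball_subset_ball (le_max_left _ _))⟩
  obtain ⟨c, hc1, hc2⟩ : ∃ c ∈ ball (0 : E) 1, c ∉ g '' sphere p R := by
    by_contra! hsub
    have h0 : volume (g '' sphere p R) = 0 :=
      addHaar_image_eq_zero_of_differentiableOn_of_addHaar_eq_zero volume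
        (hg.differentiable one_ne_zero).differentiableOn (Measure.addHaar_sphere volume p R)
    exact (measure_ball_pos volume (0 : E) one_pos).ne' (measure_mono_null hsub h0)
  let F : E → E := fun x => p + max 1 (R / ‖f x - p‖) • (f x - p)
  have hne : ∀ x, ‖f x - p‖ ≠ 0 := fun x => norm_ne_zero_iff.mpr (sub_ne_zero.mpr (hp x))
  have hF : Continuous F := by
    have : Continuous fun x => f x - p := by fun_prop
    exact continuous_const.add
      ((continuous_const.max (continuous_const.div this.norm hne)).smul this)
  have hF1 : ∀ x, R ≤ ‖f x - p‖ → F x = f x := by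
    intro x hx
    have : R / ‖f x - p‖ ≤ 1 := div_le_one_of_le₀ hx (norm_nonneg _)
    simp [F, max_eq_left this]
  have hF2 : ∀ x, ‖f x - p‖ ≤ R → F x ∈ sphere p R := by
    intro x hx
    have : 1 ≤ R / ‖f x - p‖ := by
      rwa [one_le_div (lt_of_le_of_ne (norm_nonneg _) (hne x).symm)]
    simp only [F, max_eq_right this, mem_sphere_iff_norm, add_sub_cancel_left, norm_smul]
    rw [Real.norm_of_nonneg (by positivity), div_mul_cancel₀ _ (hne x)]
  have hcont : Continuous fun x => g (F x) - x := (hg.continuous.comp hF).sub continuous_id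
  obtain ⟨M, hM⟩ := (hproper _ (isCompact_closedBall p R)).isCompact_closure
    |>.exists_bound_of_continuousOn hcont.continuousOn
  have hbound : ∀ x, ‖g (F x) - x‖ ≤ max C M := by
    intro x
    rcases le_total ‖f x - p‖ R with h | h
    · exact (hM x (subset_closure (by simpa [dist_eq_norm] using h))).trans (le_max_right _ _)
    · rw [hF1 x h]
      exact (hgf x).trans (le_max_left _ _)
  obtain ⟨x, hx⟩ := surjective_of_norm_sub_id_le (hg.continuous.comp hF) hbound c
  rcases le_or_gt ‖f x - p‖ R with h | h
  · exact hc2 ⟨F x, hF2 x h, hx⟩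
  · have hx' : g (f x) = c := by rw [← hF1 x h.le]; exact hx
    have hxC : x ∈ closedBall (0 : E) (C + 1) := by
      have h1 := hgf x
      rw [hx', norm_sub_rev] at h1
      rw [mem_ball_zero_iff] at hc1
      rw [mem_closedBall_zero_iff]
      linarith [norm_le_norm_sub_add x c]
    have := hRsub (mem_image_of_mem f hxC)
    rw [mem_ball_iff_norm] at this
    linarith

end Finite

section Coarse

variable {G : Type*} [AddGroup G] {E : Type*} [NormedAddCommGroup E]

/-- A truncated cone function on `E`, equal to `0` within distance `D` of the centre `c`
and to `1` beyond distance `D + 1`. -/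
def tentWeight (D : ℝ) (c x : E) : ℝ := max 0 (min 1 (‖x - c‖ - D))

theorem continuous_tentWeight (D : ℝ) (c : E) : Continuous (tentWeight D c) := by
  unfold tentWeight
  fun_prop

theorem tentWeight_mem_Icc (D : ℝ) (c x : E) : tentWeight D c x ∈ Icc (0 : ℝ) 1 :=
  ⟨le_max_left _ _, max_le zero_le_one (min_le_left _ _)⟩

theorem tentWeight_eq_zero {D : ℝ} {c x : E} (h : ‖x - c‖ ≤ D) : tentWeight D c x = 0 :=
  max_eq_left ((min_le_right _ _).trans (by linarith))

theorem tentWeight_eq_one {D : ℝ} {c x : E} (h : D + 1 ≤ ‖x - c‖) : tentWeight D c x = 1 := by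
  rw [tentWeight, min_eq_left (by linarith), max_eq_right zero_le_one]

variable [AddAction G E]

theorem isBounded_preimage_of_coarsely_equivariant
    (hpd : ∀ K L : Set E, IsCompact K → IsCompact L → {g : G | ∃ y ∈ K, g +ᵥ y ∈ L}.Finite)
    {l : G → E} {D : ℝ} (hD : ∀ x, ∃ m, ‖x - l m‖ ≤ D) {f : E → E} {L : Set E} (hL : IsCompact L)
    (hfL : ∀ x m, ‖x - l m‖ ≤ D → -m +ᵥ f x ∈ L) {Q : Set E} (hQ : IsCompact Q) :
    Bornology.IsBounded (f ⁻¹' Q) := by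
  refine ((Bornology.isBounded_biUnion (hpd Q L hQ hL)).mpr
    fun g _ => isBounded_closedBall (x := l (-g)) (r := D)).subset fun x hx => ?_
  obtain ⟨m, hm⟩ := hD x
  refine mem_biUnion (x := -m) ⟨f x, hx, hfL x m hm⟩ ?_
  simpa [dist_eq_norm] using hm

variable [NormedSpace ℝ E]

/-- The contraction of `E` onto the point `b +ᵥ 0` obtained by translating the linear contraction
by `b`. -/
def translatedContraction (b : G) (t : ℝ) (y : E) : E := b +ᵥ t • (-b +ᵥ y)

theorem continuous_translatedContraction (hcont : ∀ g : G, Continuous fun x : E => g +ᵥ x) (b : G) :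
    Continuous fun q : ℝ × E => translatedContraction b q.1 q.2 :=
  (hcont b).comp (continuous_fst.smul ((hcont (-b)).comp continuous_snd))

theorem translatedContraction_one (b : G) (y : E) : translatedContraction b 1 y = y := by
  simp [translatedContraction]

theorem translatedContraction_zero (b : G) (y : E) :
    translatedContraction b 0 y = b +ᵥ (0 : E) := by
  simp [translatedContraction]

theorem vadd_translatedContraction (m b : G) (t : ℝ) (y : E) :
    m +ᵥ translatedContraction b t y = translatedContraction (m + b) t (m +ᵥ y) := by
  simp [translatedContraction, vadd_vadd, add_assoc]

/-- The points reached from `B +ᵥ 0` by at most `q` translated contractions with centres in `B`. -/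
def contractionHull (B : Set G) : ℕ → Set E
  | 0 => ⋃ b ∈ B, {b +ᵥ (0 : E)}
  | q + 1 => contractionHull B q ∪
      ⋃ b ∈ B, (fun r : ℝ × E => translatedContraction b r.1 r.2) ''
        (Icc 0 1 ×ˢ contractionHull B q)

theorem isCompact_contractionHull (hcont : ∀ g : G, Continuous fun x : E => g +ᵥ x) {B : Set G}
    (hB : B.Finite) (q : ℕ) : IsCompact (contractionHull B q : Set E) := by
  induction q with
  | zero => exact hB.isCompact_biUnion fun _ _ => isCompact_singleton
  | succ q ih =>
    exact ih.union (hB.isCompact_biUnion fun b _ =>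
      (isCompact_Icc.prod ih).image (continuous_translatedContraction hcont b))

theorem contractionHull_mono (B : Set G) : Monotone (contractionHull B : ℕ → Set E) :=
  monotone_nat_of_le_succ fun _ => subset_union_left

theorem translatedContraction_mem_contractionHull {B : Set G} {b : G} (hb : b ∈ B) {t : ℝ}
    (ht : t ∈ Icc (0 : ℝ) 1) {q : ℕ} {y : E} (hy : y ∈ contractionHull B q) :
    translatedContraction b t y ∈ contractionHull B (q + 1) :=
  Or.inr (mem_biUnion hb ⟨(t, y), ⟨ht, hy⟩, rfl⟩)

/-- Contract successively towards the orbit points labelled `e 0, …, e (j - 1)`, with the weights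
at `x` of the corresponding points of `E`. -/
def iteratedContraction (l : G → E) (D : ℝ) (e : ℕ → G) : ℕ → E → E
  | 0, _ => 0
  | j + 1, x => translatedContraction (e j) (tentWeight D (l (e j)) x)
      (iteratedContraction l D e j x)

theorem continuous_iteratedContraction (hcont : ∀ g : G, Continuous fun x : E => g +ᵥ x)
    (l : G → E) (D : ℝ) (e : ℕ → G) (j : ℕ) : Continuous (iteratedContraction l D e j) := by
  induction j with
  | zero => exact continuous_const
  | succ j ih =>
    exact (continuous_translatedContraction hcont (e j)).comp
      ((continuous_tentWeight D _).prodMk ih)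

theorem iteratedContraction_succ_of_le {l : G → E} {D : ℝ} {e : ℕ → G} {j : ℕ} {x : E}
    (h : D + 1 ≤ ‖x - l (e j)‖) :
    iteratedContraction l D e (j + 1) x = iteratedContraction l D e j x := by
  rw [iteratedContraction, tentWeight_eq_one h, translatedContraction_one]

theorem exists_iteratedContraction_stable {l : G → E} (hl : ∀ r, {b | ‖l b‖ ≤ r}.Finite)
    (D : ℝ) (e : ℕ ≃ G) (x : E) :
    ∃ J, ∀ j ≥ J, ∀ x' ∈ ball x 1,
      iteratedContraction l D e j x' = iteratedContraction l D e J x' := by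
  obtain ⟨J, hJ⟩ : ∃ J, ∀ j ≥ J, ‖x‖ + D + 2 < ‖l (e j)‖ := by
    have hfin : {j | ‖l (e j)‖ ≤ ‖x‖ + D + 2}.Finite :=
      (hl (‖x‖ + D + 2)).preimage e.injective.injOn
    obtain ⟨N, hN⟩ := hfin.bddAbove
    refine ⟨N + 1, fun j hj => ?_⟩
    by_contra! h
    have := hN h
    omega
  refine ⟨J, fun j hj x' hx' => ?_⟩
  induction j, hj using Nat.le_induction with
  | base => rfl
  | succ j hj ih =>
    rw [iteratedContraction_succ_of_le, ih]
    rw [mem_ball_iff_norm] at hx'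
    have h1 := norm_le_norm_add_norm_sub x x'
    have h2 := norm_sub_norm_le (l (e j)) x'
    rw [norm_sub_rev] at h2
    have h3 := norm_le_norm_add_norm_sub' x' x
    linarith [hJ j hj]

theorem neg_vadd_iteratedContraction_mem (l : G →+ E) (D : ℝ) (e : ℕ ≃ G) {x : E} {j₀ : ℕ}
    (hx : ‖x - l (e j₀)‖ ≤ D) (d : ℕ) :
    -e j₀ +ᵥ iteratedContraction l D e (j₀ + 1 + d) x ∈
      contractionHull {b | ‖l b‖ ≤ 2 * D + 1}
        {i ∈ Finset.range d | ‖x - l (e (j₀ + 1 + i))‖ < D + 1}.card := by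
  have hD : 0 ≤ D := (norm_nonneg _).trans hx
  induction d with
  | zero =>
    have h0 : (0 : G) ∈ {b : G | ‖l b‖ ≤ 2 * D + 1} := by
      simp only [mem_ofPred_eq, map_zero, norm_zero]
      linarith
    rw [add_zero, iteratedContraction, tentWeight_eq_zero hx, translatedContraction_zero]
    refine mem_biUnion h0 ?_
    simp [vadd_vadd]
  | succ d ih =>
    rw [Finset.range_add_one, Finset.filter_insert, ← add_assoc]
    split_ifs with h
    · rw [Finset.card_insert_of_notMem (by simp), iteratedContraction, vadd_translatedContraction]
      refine translatedContraction_mem_contractionHull ?_ (tentWeight_mem_Icc _ _ _) ih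
      have h1 : l (-e j₀ + e (j₀ + 1 + d)) = (x - l (e j₀)) - (x - l (e (j₀ + 1 + d))) := by
        rw [map_add, map_neg]
        abel
      simp only [mem_ofPred_eq, h1]
      exact (norm_sub_le _ _).trans (by linarith)
    · rwa [iteratedContraction_succ_of_le (not_lt.mp h)]

/-- If `l : G →+ E` is proper for the discrete topology on `G`, then for every
continuous action of `G` on `E` there is a continuous self-map of `E` that is coarsely
equivariant. -/
theorem exists_coarsely_equivariant_map (hcont : ∀ g : G, Continuous fun x : E => g +ᵥ x)
    (l : G →+ E) (hl : ∀ r, {b | ‖l b‖ ≤ r}.Finite) (D : ℝ) (e : ℕ ≃ G) :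
    ∃ f : E → E, Continuous f ∧ ∃ L : Set E, IsCompact L ∧
      ∀ x m, ‖x - l m‖ ≤ D → -m +ᵥ f x ∈ L := by
  choose J hJ using exists_iteratedContraction_stable hl D e
  have hf : ∀ x x', x' ∈ ball x 1 →
      iteratedContraction l D e (J x') x' = iteratedContraction l D e (J x) x' := by
    intro x x' hx'
    rw [← hJ x' (max (J x) (J x')) (le_max_right _ _) x' (mem_ball_self one_pos),
      hJ x (max (J x) (J x')) (le_max_left _ _) x' hx']
  let B : Set G := {b | ‖l b‖ ≤ 2 * D + 1}
  have hB : B.Finite := hl _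
  refine ⟨fun x => iteratedContraction l D e (J x) x, ?_, contractionHull B B.ncard,
    isCompact_contractionHull hcont hB _, fun x m hm => ?_⟩
  · refine continuous_iff_continuousAt.mpr fun x => ?_
    refine (continuous_iteratedContraction hcont l D e (J x)).continuousAt.congr ?_
    filter_upwards [ball_mem_nhds x one_pos] with x' hx' using (hf x x' hx').symm
  · obtain ⟨j₀, rfl⟩ := e.surjective m
    have h := neg_vadd_iteratedContraction_mem l D e hm (J x)
    rw [hJ x (j₀ + 1 + J x) (by omega) x (mem_ball_self one_pos)] at h
    refine contractionHull_mono B ?_ h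
    rw [← Set.ncard_coe_finset]
    refine Set.ncard_le_ncard_of_injOn (fun i => -e j₀ + e (j₀ + 1 + i)) ?_ ?_ hB
    · intro i hi
      simp only [Finset.coe_filter, mem_ofPred_eq] at hi
      have h1 : l (-e j₀ + e (j₀ + 1 + i)) = (x - l (e j₀)) - (x - l (e (j₀ + 1 + i))) := by
        rw [map_add, map_neg]
        abel
      simp only [B, mem_ofPred_eq, h1]
      exact (norm_sub_le _ _).trans (by linarith [hi.2])
    · intro i _ i' _ hii
      have := e.injective (add_left_cancel hii)
      omega

open Manifold in
/-- A coarsely equivariant map into a properly discontinuous action has a smooth coarse left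
inverse. -/
theorem exists_contDiff_coarse_left_inverse [FiniteDimensional ℝ E]
    (hcont : ∀ g : G, Continuous fun x : E => g +ᵥ x)
    (hpd : ∀ K L : Set E, IsCompact K → IsCompact L → {g : G | ∃ y ∈ K, g +ᵥ y ∈ L}.Finite)
    (l : G →+ E) {D : ℝ} (hD : ∀ x, ∃ m, ‖x - l m‖ ≤ D) {f : E → E} (hf : Continuous f)
    {L : Set E} (hL : IsCompact L) (hfL : ∀ x m, ‖x - l m‖ ≤ D → -m +ᵥ f x ∈ L) :
    ∃ g : E → E, ContDiff ℝ 1 g ∧ ∃ C, ∀ x, ‖g (f x) - x‖ ≤ C := by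
  have hclosed : IsClosed (range f) := by
    refine (isProperMap_iff_isCompact_preimage.mpr ⟨hf, fun Q hQ => ?_⟩).isClosedMap.isClosed_range
    exact isCompact_of_isClosed_isBounded (hQ.isClosed.preimage hf)
      (isBounded_preimage_of_coarsely_equivariant hpd hD hL hfL hQ)
  obtain ⟨N, hN, hLN⟩ := exists_compact_superset hL
  obtain ⟨C, hC⟩ : ∃ C, ∀ b : G, (∃ y ∈ N, b +ᵥ y ∈ N) → ‖l b‖ ≤ C := by
    obtain ⟨C, hC⟩ := ((hpd N N hN hN).image fun b => ‖l b‖).bddAbove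
    exact ⟨C, fun b hb => hC (mem_image_of_mem _ hb)⟩
  let t : E → Set E := fun y => {v | ∀ x, f x = y → ‖v - x‖ ≤ C + D}
  have hconv : ∀ y, Convex ℝ (t y) := by
    intro y
    have : t y = ⋂ x, ⋂ (_ : f x = y), closedBall x (C + D) := by
      ext v
      simp [t, dist_eq_norm]
    rw [this]
    exact convex_iInter₂ fun x _ => convex_closedBall _ _
  have hloc : ∀ y, ∃ v, ∀ᶠ z in 𝓝 y, v ∈ t z := by
    intro y
    by_cases hy : y ∈ range f
    · obtain ⟨x₀, rfl⟩ := hy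
      obtain ⟨m₀, hm₀⟩ := hD x₀
      refine ⟨l m₀, ?_⟩
      filter_upwards [(isOpen_interior.preimage (hcont (-m₀))).mem_nhds (hLN (hfL x₀ m₀ hm₀))]
      rintro _ hU x rfl
      obtain ⟨m, hm⟩ := hD x
      have h1 := hC (-m₀ + m) ⟨-m +ᵥ f x, interior_subset (hLN (hfL x m hm)), by
        simpa [vadd_vadd] using interior_subset hU⟩
      have h2 : l m₀ - x = -(l (-m₀ + m)) - (x - l m) := by
        rw [map_add, map_neg]
        abel
      rw [h2]
      refine (norm_sub_le _ _).trans ?_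
      rw [norm_neg]
      linarith
    · refine ⟨0, ?_⟩
      filter_upwards [hclosed.isOpen_compl.mem_nhds hy] with z hz x hx
      exact absurd ⟨x, hx⟩ hz
  obtain ⟨g, hg⟩ := exists_contMDiffMap_forall_mem_convex_of_local_const 𝓘(ℝ, E) (n := 1)
    hconv hloc
  exact ⟨g, g.contMDiff.contDiff, C + D, fun x => hg (f x) x rfl⟩

end Coarse

/-- The inclusion of the integer lattice in a Euclidean space. -/
def integerLattice (n : ℕ) : (Fin n → ℤ) →+ EuclideanSpace ℝ (Fin n) where
  toFun m := WithLp.toLp 2 fun i => (m i : ℝ)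
  map_zero' := by ext; simp
  map_add' a b := by ext; simp

theorem finite_norm_integerLattice_le (n : ℕ) (r : ℝ) : {b | ‖integerLattice n b‖ ≤ r}.Finite := by
  refine (finite_Icc (fun _ => -⌈r⌉ : Fin n → ℤ) fun _ => ⌈r⌉).subset fun b hb => ?_
  have h : ∀ i, |(b i : ℝ)| ≤ ⌈r⌉ := fun i =>
    ((PiLp.norm_apply_le (integerLattice n b) i).trans hb).trans (Int.le_ceil r)
  exact ⟨fun i => by exact_mod_cast (abs_le.mp (h i)).1, fun i => by
    exact_mod_cast (abs_le.mp (h i)).2⟩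

theorem exists_norm_sub_integerLattice_le {n : ℕ} (x : EuclideanSpace ℝ (Fin n)) :
    ∃ m, ‖x - integerLattice n m‖ ≤ √n := by
  refine ⟨fun i => ⌊x i⌋, ?_⟩
  rw [EuclideanSpace.norm_eq]
  refine Real.sqrt_le_sqrt ?_
  calc _ ≤ ∑ _i : Fin n, (1 : ℝ) := by
        refine Finset.sum_le_sum fun i _ => ?_
        have : (x - integerLattice n fun i => ⌊x i⌋) i = Int.fract (x i) := rfl
        rw [this, Real.norm_of_nonneg (Int.fract_nonneg _)]
        exact pow_le_one₀ (Int.fract_nonneg _) (Int.fract_lt_one _).le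
    _ = n := by simp

/-- A properly discontinuous action of `ℤⁿ` on `ℝⁿ` admits a compact set whose translates cover
`ℝⁿ`. -/
theorem exists_isCompact_vadd_cover {n : ℕ} (hn : n ≠ 0)
    [AddAction (Fin n → ℤ) (EuclideanSpace ℝ (Fin n))]
    (hcont : ∀ g : Fin n → ℤ, Continuous fun x : EuclideanSpace ℝ (Fin n) => g +ᵥ x)
    (hpd : ∀ K L : Set (EuclideanSpace ℝ (Fin n)), IsCompact K → IsCompact L →
      {g : Fin n → ℤ | ∃ y ∈ K, g +ᵥ y ∈ L}.Finite) :
    ∃ L : Set (EuclideanSpace ℝ (Fin n)), IsCompact L ∧ ∀ y, ∃ m : Fin n → ℤ, m +ᵥ y ∈ L := by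
  have : Nonempty (Fin n) := Fin.pos_iff_nonempty.mp (Nat.pos_of_ne_zero hn)
  obtain ⟨e⟩ := nonempty_equiv_of_countable (α := ℕ) (β := Fin n → ℤ)
  obtain ⟨f, hf, L, hL, hfL⟩ := exists_coarsely_equivariant_map hcont (integerLattice n)
    (finite_norm_integerLattice_le n) √n e
  obtain ⟨g, hg, C, hgC⟩ := exists_contDiff_coarse_left_inverse hcont hpd (integerLattice n)
    exists_norm_sub_integerLattice_le hf hL hfL
  refine ⟨L, hL, fun y => ?_⟩
  obtain ⟨x, rfl⟩ := surjective_of_coarse_left_inverse hf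
    (fun Q hQ => isBounded_preimage_of_coarsely_equivariant hpd
      exists_norm_sub_integerLattice_le hL hfL hQ) hg hgC y
  obtain ⟨m, hm⟩ := exists_norm_sub_integerLattice_le x
  exact ⟨-m, hfL x m hm⟩

/-- Extension of integer vectors by zero. -/
noncomputable def extendByZero {n k : ℕ} (h : n ≤ k) : (Fin n → ℤ) →+ (Fin k → ℤ) where
  toFun := fun m => Function.extend (Fin.castLE h) m 0
  map_zero' := Function.extend_zero _
  map_add' a b := by simpa using Function.extend_add (Fin.castLE h) a b 0 0

theorem extendByZero_injective {n k : ℕ} (h : n ≤ k) : Function.Injective (extendByZero h) :=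
  Function.extend_injective (Fin.castLE_injective h) 0

/-- If `ℤᵏ` acts on `ℝⁿ` by homeomorphisms, continuously, freely and properly
discontinuously, and the orbit space `ℝⁿ/ℤᵏ` is not compact, then `k < n`. -/
theorem lt_of_free_properlyDiscontinuous_zk_action_noncompact_quotient (n k : ℕ)
    [AddAction (Fin k → ℤ) (EuclideanSpace ℝ (Fin n))]
    (hcont : ∀ g : Fin k → ℤ, Continuous fun x : EuclideanSpace ℝ (Fin n) => g +ᵥ x)
    (hfree : ∀ (g : Fin k → ℤ) (x : EuclideanSpace ℝ (Fin n)), g +ᵥ x = x → g = 0)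
    (hpd : ∀ K L : Set (EuclideanSpace ℝ (Fin n)), IsCompact K → IsCompact L →
      {g : Fin k → ℤ | (g +ᵥ K) ∩ L ≠ ∅}.Finite)
    (hnc : ¬ CompactSpace
      (Quotient (AddAction.orbitRel (Fin k → ℤ) (EuclideanSpace ℝ (Fin n))))) :
    k < n := by
  by_contra! hle
  refine hnc ?_
  rcases eq_or_ne n 0 with rfl | hn
  · exact Quotient.compactSpace
  let : AddAction (Fin n → ℤ) (EuclideanSpace ℝ (Fin n)) :=
    AddAction.compHom _ (extendByZero hle)
  obtain ⟨L, hL, hcover⟩ := exists_isCompact_vadd_cover hn (fun g => hcont (extendByZero hle g))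
    (fun K L hK hL => ((hpd K L hK hL).preimage (extendByZero_injective hle).injOn).subset
      fun g ⟨y, hy, hgy⟩ => Set.nonempty_iff_ne_empty.mp
        ⟨_, Set.vadd_mem_vadd_set hy, hgy⟩)
  refine ⟨?_⟩
  convert hL.image continuous_quotient_mk'
  refine (Set.eq_univ_of_forall fun q => ?_).symm
  induction q using Quotient.inductionOn with
  | h y =>
    obtain ⟨m, hm⟩ := hcover y
    exact ⟨m +ᵥ y, hm, Quotient.sound ⟨extendByZero hle m, rfl⟩⟩
end

section
/- Let n be a natural number and suppose the group ℤⁿ acts on Euclidean space ℝⁿ by homeomorphisms, the action being continuous, free, and properly discontinuous. Then the orbit space ℝⁿ/ℤⁿ is compact. -/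
open Pointwise

section Degree

open MeasureTheory Polynomial

/-- The functions `φ : X → ℝ → ℝ` that are polynomial in the second variable, with coefficients
depending continuously on the first one. -/
def IsPolynomialFamily {X : Type*} [TopologicalSpace X] (φ : X → ℝ → ℝ) : Prop :=
  ∃ p : C(X, ℝ)[X], ∀ x t,
    φ x t = p.eval₂ ((Pi.evalRingHom _ x).comp ContinuousMap.coeFnRingHom) t

namespace IsPolynomialFamily

variable {Y : Type*} [TopologicalSpace Y]

theorem const (c : ℝ) : IsPolynomialFamily fun (_ : Y) _ => c :=
  ⟨C (ContinuousMap.const Y c), fun x t => by simp⟩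

theorem add {φ ψ : Y → ℝ → ℝ} (hφ : IsPolynomialFamily φ) (hψ : IsPolynomialFamily ψ) :
    IsPolynomialFamily fun x t => φ x t + ψ x t := by
  obtain ⟨p, hp⟩ := hφ
  obtain ⟨q, hq⟩ := hψ
  exact ⟨p + q, fun x t => by simp only [hp, hq, eval₂_add]⟩

theorem mul {φ ψ : Y → ℝ → ℝ} (hφ : IsPolynomialFamily φ) (hψ : IsPolynomialFamily ψ) :
    IsPolynomialFamily fun x t => φ x t * ψ x t := by
  obtain ⟨p, hp⟩ := hφ
  obtain ⟨q, hq⟩ := hψ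
  exact ⟨p * q, fun x t => by simp only [hp, hq, eval₂_mul]⟩

theorem affine {a b : Y → ℝ} (ha : Continuous a) (hb : Continuous b) :
    IsPolynomialFamily fun x t => a x + t * b x :=
  ⟨C ⟨a, ha⟩ + X * C ⟨b, hb⟩, fun x t => by
    simp [eval₂_add, mul_comm t]⟩

/-- Integrating a polynomial family over a compact set yields a polynomial. -/
theorem exists_setIntegral_eq_eval {φ : Y → ℝ → ℝ} (hφ : IsPolynomialFamily φ)
    [T2Space Y] [MeasurableSpace Y] [BorelSpace Y] (μ : Measure Y) [IsFiniteMeasureOnCompacts μ]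
    {K : Set Y} (hK : IsCompact K) :
    ∃ q : ℝ[X], ∀ t, ∫ x in K, φ x t ∂μ = q.eval t := by
  obtain ⟨p, hp⟩ := hφ
  refine ⟨∑ k ∈ p.support, C (∫ x in K, p.coeff k x ∂μ) * X ^ k, fun t => ?_⟩
  simp only [hp, eval₂_eq_sum, Polynomial.sum]
  rw [integral_finsetSum]
  · simp [eval_finsetSum, integral_mul_const]
  · intro k _
    exact (((p.coeff k).continuous.mul continuous_const).continuousOn).integrableOn_compact hK

theorem det_one_add {E : Type*} [NormedAddCommGroup E] [NormedSpace ℝ E] [FiniteDimensional ℝ E]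
    {A : E → E →L[ℝ] E} (hA : Continuous A) :
    IsPolynomialFamily fun x t => (1 + t • A x).det := by
  classical
  let b := Module.finBasis ℝ E
  have hc : ∀ i j, Continuous fun x => LinearMap.toMatrix b b (A x : E →ₗ[ℝ] E) i j := by
    intro i j
    simp only [LinearMap.toMatrix_apply, ContinuousLinearMap.coe_coe]
    exact (b.coord i).continuous_of_finiteDimensional.comp (hA.clm_apply continuous_const)
  let M : Matrix (Fin (Module.finrank ℝ E)) (Fin (Module.finrank ℝ E)) C(E, ℝ) :=
    Matrix.of fun i j => ⟨_, hc i j⟩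
  refine ⟨(1 + (X : C(E, ℝ)[X]) • M.map C).det, fun x t => ?_⟩
  rw [← coe_eval₂RingHom, RingHom.map_det]
  change LinearMap.det _ = _
  rw [← LinearMap.det_toMatrix b]
  congr 1
  ext i j
  simp only [RingHom.mapMatrix_apply, Matrix.map_apply, Matrix.add_apply, map_add,
    Matrix.smul_apply, smul_eq_mul, coe_eval₂RingHom, eval₂_mul, eval₂_X, eval₂_C,
    ContinuousLinearMap.toLinearMap_add, ContinuousLinearMap.toLinearMap_smul, map_smul]
  refine congrArg₂ _ ?_ rfl
  rcases eq_or_ne i j with rfl | hij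
  · simp [LinearMap.toMatrix_apply]
  · simp [LinearMap.toMatrix_apply, hij]

end IsPolynomialFamily

variable {E : Type*} [NormedAddCommGroup E] [NormedSpace ℝ E] [FiniteDimensional ℝ E]

theorem bijective_id_add_of_lipschitz {K : NNReal} {g : E → E} (hg : LipschitzWith K g)
    (hK : K < 1) : Function.Bijective fun x => x + g x := by
  have h : ApproximatesLinearOn (fun x => x + g x)
      (ContinuousLinearEquiv.refl ℝ E : E →L[ℝ] E) Set.univ K := by
    intro x _ y _
    simpa [add_sub_add_comm, dist_eq_norm] using hg.dist_le_mul x y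
  have hc : Subsingleton E ∨
      K < ‖((ContinuousLinearEquiv.refl ℝ E).symm : E →L[ℝ] E)‖₊⁻¹ := by
    rcases subsingleton_or_nontrivial E with hE | hE
    · exact Or.inl hE
    · right
      have : ‖((ContinuousLinearEquiv.refl ℝ E).symm : E →L[ℝ] E)‖₊ = 1 := by
        apply NNReal.eq
        exact ContinuousLinearMap.norm_id
      simpa [this] using hK
  exact ⟨Set.injOn_univ.1 (h.injOn hc), h.surjective hc⟩

theorem exists_setIntegral_comp_id_add_smul_eq [MeasurableSpace E] [BorelSpace E] (μ : Measure E)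
    [μ.IsAddHaarMeasure] {g : E → E} (hg : ContDiff ℝ 1 g) {B : Set E} (hB : IsCompact B)
    (hgB : ∀ x ∉ B, g x = 0) :
    ∃ δ > 0, ∀ t : ℝ, |t| < δ → ∀ ρ : E → ℝ,
      ∫ x in B, ρ (x + t • g x) * (1 + t • fderiv ℝ g x).det ∂μ = ∫ x in B, ρ x ∂μ := by
  obtain ⟨K, hK⟩ := hg.lipschitzWith_of_hasCompactSupport
    (HasCompactSupport.intro hB hgB) one_ne_zero
  have hdet : ∀ᶠ A : E →L[ℝ] E in nhds 1, 0 < A.det :=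
    (ContinuousLinearMap.continuous_det.tendsto 1).eventually_const_lt
      (by simp [ContinuousLinearMap.det])
  obtain ⟨ε, hε, hεdet⟩ := Metric.eventually_nhds_iff.1 hdet
  refine ⟨min 1 ε / (K + 1), by positivity, fun t ht ρ => ?_⟩
  have ht' : |t| * (K + 1) < min 1 ε := (lt_div_iff₀ (by positivity)).1 ht
  have hKt : |t| * K < min 1 ε := by nlinarith [abs_nonneg t]
  have hbij : Function.Bijective fun x => x + t • g x := by
    refine bijective_id_add_of_lipschitz (K := ‖t‖₊ * K) ((lipschitzWith_smul t).comp hK) ?_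
    rw [← NNReal.coe_lt_coe]
    simpa using hKt.trans_le (min_le_left _ _)
  have himage : (fun x => x + t • g x) '' B = B := by
    rw [← compl_inj_iff, ← Set.image_compl_eq hbij]
    exact (Set.image_congr fun x hx => by simp [hgB x hx]).trans (Set.image_id _)
  have hpos : ∀ x, 0 < (1 + t • fderiv ℝ g x).det := by
    intro x
    refine hεdet ?_
    rw [dist_eq_norm, add_sub_cancel_left, norm_smul, Real.norm_eq_abs]
    calc |t| * ‖fderiv ℝ g x‖ ≤ |t| * K := by gcongr; exact norm_fderiv_le_of_lipschitz ℝ hK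
      _ < ε := hKt.trans_le (min_le_right _ _)
  have hderiv : ∀ x ∈ B, HasFDerivWithinAt (fun x => x + t • g x) (1 + t • fderiv ℝ g x) B x :=
    fun x _ => ((hasFDerivAt_id x).add
      ((hg.differentiable one_ne_zero x).hasFDerivAt.const_smul t)).hasFDerivWithinAt
  have := integral_image_eq_integral_abs_det_fderiv_smul μ hB.measurableSet hderiv
    hbij.injective.injOn ρ
  rw [himage] at this
  rw [this]
  simp only [abs_of_pos (hpos _), smul_eq_mul, mul_comm]

/-- A compactly supported `C¹` perturbation of the identity has dense range. -/
theorem exists_norm_add_sub_lt_of_contDiff {g : E → E} (hg : ContDiff ℝ 1 g)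
    (hsupp : HasCompactSupport g) (c : E) {ε : ℝ} (hε : 0 < ε) :
    ∃ x, ‖x + g x - c‖ < ε := by
  by_contra! hmiss
  borelize E
  let μ : Measure E := Measure.addHaar
  obtain ⟨R, hR, hgR⟩ : ∃ R > 0, ∀ x ∉ Metric.closedBall c R, g x = 0 := by
    obtain ⟨R, hR⟩ := hsupp.isCompact.isBounded.subset_closedBall c
    refine ⟨max R 1, by positivity, fun x hx => ?_⟩
    by_contra h
    exact hx (Metric.closedBall_subset_closedBall (le_max_left _ _)
      (hR (subset_tsupport g h)))
  set B := Metric.closedBall c R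
  have hB : IsCompact B := isCompact_closedBall c R
  obtain ⟨δ, hδ, hsmall⟩ := exists_setIntegral_comp_id_add_smul_eq μ hg hB hgR
  have hg' : Continuous (fderiv ℝ g) := hg.continuous_fderiv one_ne_zero
  have hJ : Continuous fun x => (1 + fderiv ℝ g x).det :=
    ContinuousLinearMap.continuous_det.comp (continuous_const.add hg')
  let A : Subalgebra ℝ C(E, ℝ) :=
    { carrier := {ρ | IsPolynomialFamily fun x t => ρ (x + t • g x)}
      mul_mem' := fun h h' => h.mul h'
      add_mem' := fun h h' => h.add h'
      algebraMap_mem' := fun r => IsPolynomialFamily.const r }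
  have hsep : A.SeparatesPoints := by
    intro x y hxy
    obtain ⟨f, hf⟩ := SeparatingDual.exists_separating_of_ne (R := ℝ) hxy
    refine ⟨f, ⟨⟨f, f.continuous⟩, ?_, rfl⟩, hf⟩
    change IsPolynomialFamily fun x t => f (x + t • g x)
    simp only [map_add, map_smul, smul_eq_mul]
    exact IsPolynomialFamily.affine f.continuous (f.continuous.comp hg.continuous)
  have hA : ∀ ρ ∈ A, ∫ x in B, ρ (x + g x) * (1 + fderiv ℝ g x).det ∂μ = ∫ x in B, ρ x ∂μ := by
    intro ρ hρ
    obtain ⟨q, hq⟩ := (IsPolynomialFamily.mul hρ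
      (IsPolynomialFamily.det_one_add hg')).exists_setIntegral_eq_eval μ hB
    have : q = C (∫ x in B, ρ x ∂μ) := by
      refine eq_of_infinite_eval_eq _ _ ((Set.Ioo_infinite (neg_lt_self hδ)).mono fun t ht => ?_)
      simp only [Set.mem_ofPred_eq, eval_C]
      rw [← hq, hsmall t (abs_lt.2 ht)]
    have h1 := hq 1
    simpa [this] using h1
  let ρ : C(E, ℝ) := ⟨fun x => max 0 (ε - ‖x - c‖), by fun_prop⟩
  have hρ0 : ∀ x, ρ (x + g x) = 0 := fun x => max_eq_left (sub_nonpos.2 (hmiss x))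
  have hρint : 0 < ∫ x in B, ρ x ∂μ := by
    have hint : IntegrableOn ρ B μ := ρ.continuous.continuousOn.integrableOn_compact hB
    have hnonneg : ∀ x, 0 ≤ ρ x := fun x => le_max_left _ _
    rw [setIntegral_pos_iff_support_of_nonneg_ae (ae_of_all _ hnonneg) hint]
    refine (Metric.measure_ball_pos μ c (lt_min hε hR)).trans_le (measure_mono fun x hx => ?_)
    rw [mem_ball_iff_norm, lt_min_iff] at hx
    refine ⟨?_, mem_closedBall_iff_norm.2 hx.2.le⟩
    exact (lt_max_of_lt_right (sub_pos.2 hx.1)).ne'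
  set I := ∫ x in B, ρ x ∂μ
  set V := μ.real B
  obtain ⟨D, hD⟩ := hB.exists_bound_of_continuousOn hJ.continuousOn
  have hD0 : 0 ≤ D := (norm_nonneg _).trans (hD c (Metric.mem_closedBall_self hR.le))
  have hV : 0 ≤ V := measureReal_nonneg
  let η := I / ((1 + D) * V + 1)
  have hη : 0 < η := by positivity
  have hcompact : IsCompact (B ∪ (fun x => x + g x) '' B) :=
    hB.union (hB.image (continuous_id.add hg.continuous))
  obtain ⟨σ, hσA, hσ⟩ :=
    ContinuousMap.exists_mem_subalgebra_near_continuous_of_isCompact_of_separatesPoints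
      hsep ρ hcompact hη
  have h1 : ‖∫ x in B, σ (x + g x) * (1 + fderiv ℝ g x).det ∂μ‖ ≤ η * D * V := by
    refine norm_setIntegral_le_of_norm_le_const hB.measure_lt_top fun x hx => ?_
    rw [norm_mul]
    refine mul_le_mul ?_ (hD x hx) (norm_nonneg _) hη.le
    simpa [hρ0] using (hσ (x + g x) (Or.inr ⟨x, hx, rfl⟩)).le
  have h2 : ‖∫ x in B, (σ x - ρ x) ∂μ‖ ≤ η * V :=
    norm_setIntegral_le_of_norm_le_const hB.measure_lt_top fun x hx => (hσ x (Or.inl hx)).le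
  rw [integral_sub (σ.continuous.continuousOn.integrableOn_compact hB)
    (ρ.continuous.continuousOn.integrableOn_compact hB)] at h2
  rw [hA σ hσA] at h1
  have h3 : I ≤ η * ((1 + D) * V) := by
    rw [Real.norm_eq_abs, abs_le] at h1 h2
    change _ ∧ _ - I ≤ _ at h2
    change -_ ≤ _ - I ∧ _ at h2
    nlinarith [h1.2, h2.1]
  have h4 : η * ((1 + D) * V + 1) = I := div_mul_cancel₀ _ (by positivity)
  linarith

/-- A continuous self-map at bounded distance from the identity is surjective. -/
theorem surjective_of_norm_sub_le {F : E → E} (hF : Continuous F) {C : ℝ}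
    (hC : ∀ x, ‖F x - x‖ ≤ C) : Function.Surjective F := by
  intro c
  by_contra! hmiss
  have hC0 : 0 ≤ C := (norm_nonneg _).trans (hC 0)
  obtain ⟨ε, hε, hε1, hεF⟩ : ∃ ε > 0, ε ≤ 1 ∧
      ∀ x ∈ Metric.closedBall c (C + 2), ε ≤ ‖F x - c‖ := by
    obtain ⟨x₀, _, hx₀⟩ := (isCompact_closedBall c (C + 2)).exists_isMinOn
      ⟨c, Metric.mem_closedBall_self (by positivity)⟩ (f := fun x => ‖F x - c‖) (by fun_prop)
    refine ⟨min ‖F x₀ - c‖ 1, lt_min (norm_pos_iff.2 (sub_ne_zero.2 (hmiss x₀))) one_pos,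
      min_le_right _ _, fun x hx => (min_le_left _ _).trans (hx₀ hx)⟩
  obtain ⟨g, hg, hgF, -⟩ := (hF.sub continuous_id).exists_contDiff_approx (ε := fun _ => ε / 2) 1
    continuous_const (fun _ => by positivity)
  simp only [dist_eq_norm, Pi.sub_apply, id] at hgF
  let χ : ContDiffBump c := ⟨C + 2, C + 3, by positivity, by linarith⟩
  obtain ⟨x, hx⟩ := exists_norm_add_sub_lt_of_contDiff (g := fun x => χ x • g x)
    ((χ.contDiff).smul hg) χ.hasCompactSupport.smul_right c (half_pos hε)
  by_cases hxB : x ∈ Metric.closedBall c (C + 2)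
  · rw [χ.one_of_mem_closedBall hxB, one_smul] at hx
    have h1 := hεF x hxB
    have h2 := hgF x
    have h3 : ‖F x - c‖ ≤ ‖x + g x - c‖ + ‖g x - (F x - x)‖ := by
      rw [← norm_neg (g x - _)]
      refine le_trans (le_of_eq ?_) (norm_add_le _ _)
      congr 1; abel
    linarith
  · rw [mem_closedBall_iff_norm, not_le] at hxB
    have h1 : ‖χ x • g x‖ ≤ C + 1 / 2 := by
      rw [norm_smul, Real.norm_of_nonneg χ.nonneg]
      have h2 : ‖g x‖ ≤ C + 1 / 2 := by
        have := norm_le_norm_add_norm_sub' (g x) (F x - x)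
        linarith [hgF x, hC x]
      nlinarith [χ.le_one (x := x), χ.nonneg (x := x), norm_nonneg (g x)]
    have h3 : ‖x - c‖ ≤ ‖x + χ x • g x - c‖ + ‖χ x • g x‖ := by
      rw [← norm_neg (χ x • g x)]
      refine le_trans (le_of_eq ?_) (norm_add_le _ _)
      congr 1; abel
    linarith

/-- If a proper map `f` has a left inverse up to bounded distance, then it is surjective. -/
theorem surjective_of_coarse_leftInverse {f h : E → E} (hf : Continuous f) (hh : Continuous h)
    (hproper : ∀ r, ∃ R, ∀ v, ‖f v‖ ≤ r → ‖v‖ ≤ R) {C : ℝ} (hC : ∀ v, ‖h (f v) - v‖ ≤ C) :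
    Function.Surjective f := by
  intro x₀
  by_contra! hmiss
  borelize E
  let μ : Measure E := Measure.addHaar
  obtain ⟨k, hk, hkh, -⟩ := hh.exists_contDiff_approx (ε := fun _ => 1) 1
    continuous_const (fun _ => one_pos)
  have hkf : ∀ v, ‖k (f v) - v‖ ≤ C + 1 := by
    intro v
    rw [← sub_add_sub_cancel _ (h (f v))]
    have := hkh (f v)
    rw [dist_eq_norm] at this
    exact (norm_add_le _ _).trans (by linarith [hC v])
  obtain ⟨S₀, hS₀⟩ := (isCompact_closedBall (0 : E) (C + 2)).exists_bound_of_continuousOn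
    (f := fun v => f v - x₀) (by fun_prop)
  obtain ⟨S, hS, hS₀S⟩ : ∃ S > 0, S₀ < S := ⟨|S₀| + 1, by positivity, by linarith [le_abs_self S₀]⟩
  have hfar : ∀ v, ‖f v - x₀‖ ≥ S → 1 < ‖k (f v)‖ := by
    intro v hv
    by_contra! hlt
    have h1 : ‖v‖ ≤ C + 2 := by
      have := norm_le_norm_add_norm_sub (k (f v)) v
      linarith [hkf v]
    linarith [hS₀ v (mem_closedBall_zero_iff.2 h1)]
  obtain ⟨c, hc1, hcS⟩ : ∃ c ∈ Metric.ball (0 : E) 1, c ∉ k '' Metric.sphere x₀ S := by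
    by_contra! hsub
    have h0 : μ (k '' Metric.sphere x₀ S) = 0 :=
      addHaar_image_eq_zero_of_differentiableOn_of_addHaar_eq_zero μ
        (hk.differentiable one_ne_zero).differentiableOn
        (Measure.addHaar_sphere_of_ne_zero μ x₀ hS.ne')
    exact (Metric.measure_ball_pos μ 0 one_pos).ne' (measure_mono_null hsub h0)
  have hne : ∀ v, ‖f v - x₀‖ ≠ 0 := fun v => norm_ne_zero_iff.2 (sub_ne_zero.2 (hmiss v))
  let f' : E → E := fun v => x₀ + max 1 (S / ‖f v - x₀‖) • (f v - x₀)
  have hf' : Continuous f' := by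
    have : Continuous fun v => S / ‖f v - x₀‖ := continuous_const.div (by fun_prop) hne
    fun_prop
  have hf'far : ∀ v, S ≤ ‖f v - x₀‖ → f' v = f v := by
    intro v hv
    have : S / ‖f v - x₀‖ ≤ 1 := (div_le_one (hS.trans_le hv)).2 hv
    simp [f', max_eq_left this]
  have hf'near : ∀ v, ‖f v - x₀‖ < S → f' v ∈ Metric.sphere x₀ S := by
    intro v hv
    have h1 : 0 < ‖f v - x₀‖ := (hne v).symm.lt_of_le (norm_nonneg _)
    have : 1 ≤ S / ‖f v - x₀‖ := (one_le_div h1).2 hv.le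
    simp only [f', max_eq_right this, mem_sphere_iff_norm, add_sub_cancel_left, norm_smul]
    rw [Real.norm_of_nonneg (by positivity), div_mul_cancel₀ _ (hne v)]
  obtain ⟨R, hR⟩ := hproper (‖x₀‖ + S)
  obtain ⟨C', hC'⟩ := (isCompact_closedBall (0 : E) R).exists_bound_of_continuousOn
    (f := fun v => k (f' v) - v) ((hk.continuous.comp hf').sub continuous_id).continuousOn
  have hbound : ∀ v, ‖k (f' v) - v‖ ≤ max (C + 1) C' := by
    intro v
    rcases le_or_gt S ‖f v - x₀‖ with hv | hv
    · rw [hf'far v hv]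
      exact (hkf v).trans (le_max_left _ _)
    · refine (hC' v (mem_closedBall_zero_iff.2 (hR v ?_))).trans (le_max_right _ _)
      linarith [norm_le_norm_add_norm_sub' (f v) x₀]
  obtain ⟨v, hv⟩ := surjective_of_norm_sub_le (hk.continuous.comp hf') hbound c
  change k (f' v) = c at hv
  rcases le_or_gt S ‖f v - x₀‖ with hle | hlt
  · rw [hf'far v hle] at hv
    rw [mem_ball_zero_iff, ← hv] at hc1
    exact (hfar v hle).not_gt hc1
  · exact hcS ⟨f' v, hf'near v hlt, hv⟩

end Degree

section EquivariantMap

variable {G E : Type*} [AddCommGroup G] [NormedAddCommGroup E] [NormedSpace ℝ E] [AddAction G E]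

/-- Contract `E` linearly towards the `g`-translate of the origin, up to time `t g`. -/
def coneStep (t : G → ℝ) (g : G) (x : E) : E :=
  g +ᵥ ((1 - t g) • (-g +ᵥ x))

theorem coneStep_of_eq_zero {t : G → ℝ} {g : G} (h : t g = 0) (x : E) : coneStep t g x = x := by
  simp [coneStep, h]

theorem coneStep_of_eq_one {t : G → ℝ} {g : G} (h : t g = 1) (x y : E) :
    coneStep t g x = coneStep t g y := by
  simp [coneStep, h]

theorem coneStep_vadd {t t' : G → ℝ} {k g : G} (h : t' (k + g) = t g) (x : E) :
    coneStep t' (k + g) (k +ᵥ x) = k +ᵥ coneStep t g x := by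
  simp only [coneStep, h, vadd_vadd]
  congr 3
  abel_nf

theorem continuous_coneStep {P : Type*} [TopologicalSpace P]
    (hcont : ∀ g : G, Continuous fun x : E => g +ᵥ x) {s : G → P → ℝ} {g : G}
    (hs : Continuous (s g)) {φ : P → E} (hφ : Continuous φ) :
    Continuous fun p => coneStep (fun g => s g p) g (φ p) :=
  (hcont g).comp ((continuous_const.sub hs).smul ((hcont (-g)).comp hφ))

variable [LinearOrder G]

/-- Apply the contractions `coneStep t g` for `g ∈ S` in decreasing order of `g`. -/
def coneFold (t : G → ℝ) (S : Finset G) (x : E) : E :=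
  (S.sort (· ≤ ·)).foldr (coneStep t) x

theorem coneFold_eq_of_eq_one {t : G → ℝ} {S : Finset G} {g : G} (hg : g ∈ S) (h : t g = 1)
    (x y : E) : coneFold t S x = coneFold t S y := by
  have key : ∀ L : List G, g ∈ L → L.foldr (coneStep t) x = L.foldr (coneStep t) y := by
    intro L hL
    induction L with
    | nil => simp at hL
    | cons a L ih =>
      rw [List.foldr_cons, List.foldr_cons]
      rcases List.mem_cons.1 hL with rfl | hL
      · exact coneStep_of_eq_one h _ _
      · rw [ih hL]
  exact key _ ((Finset.mem_sort _).2 hg)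

theorem coneFold_eq_of_subset {t : G → ℝ} {S T : Finset G} (hST : S ⊆ T)
    (h : ∀ g ∉ S, t g = 0) (x : E) : coneFold t T x = coneFold t S x := by
  have key : ∀ L : List G,
      L.foldr (coneStep t) x = (L.filter (· ∈ S)).foldr (coneStep t) x := by
    intro L
    induction L with
    | nil => rfl
    | cons a L ih =>
      by_cases ha : a ∈ S
      · simp [ha, ih]
      · simp [ha, ih, coneStep_of_eq_zero (h a ha)]
  have hsort : (T.sort (· ≤ ·)).filter (· ∈ S) = S.sort (· ≤ ·) := by
    refine List.Perm.eq_of_pairwise' (r := (· ≤ ·)) ((Finset.pairwise_sort T _).filter _)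
      (Finset.pairwise_sort S _) ?_
    refine (List.perm_ext_iff_of_nodup ((Finset.sort_nodup T _).filter _)
      (Finset.sort_nodup S _)).2 fun a => ?_
    simpa using fun ha => hST ha
  rw [coneFold, coneFold, key, hsort]

theorem coneFold_map_addLeft (hle : ∀ k a b : G, a ≤ b ↔ k + a ≤ k + b) {t t' : G → ℝ} {k : G}
    (h : ∀ g, t' (k + g) = t g) (S : Finset G) (x : E) :
    coneFold t' (S.map (addLeftEmbedding k)) (k +ᵥ x) = k +ᵥ coneFold t S x := by
  rw [coneFold, coneFold, ← Finset.map_sort (r := (· ≤ ·)) _ _ _ fun a _ b _ => hle k a b]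
  induction S.sort (· ≤ ·) with
  | nil => rfl
  | cons a L ih =>
    rw [List.map_cons, List.foldr_cons, List.foldr_cons, ih]
    exact coneStep_vadd (h a) _

theorem continuous_coneFold {P : Type*} [TopologicalSpace P]
    (hcont : ∀ g : G, Continuous fun x : E => g +ᵥ x) {s : G → P → ℝ}
    (hs : ∀ g, Continuous (s g)) (S : Finset G) (x : E) :
    Continuous fun p => coneFold (fun g => s g p) S x := by
  unfold coneFold
  induction S.sort (· ≤ ·) with
  | nil => exact continuous_const
  | cons a L ih => exact continuous_coneStep hcont (hs a) ih

/-- A locally finite equivariant family of weights, one of which equals `1` at each point, gives an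
equivariant map to any normed space on which the group acts by homeomorphisms. -/
theorem exists_equivariant_map {P : Type*} [TopologicalSpace P]
    (hle : ∀ k a b : G, a ≤ b ↔ k + a ≤ k + b)
    (hcont : ∀ g : G, Continuous fun x : E => g +ᵥ x) (T : G → P → P) {s : G → P → ℝ}
    (hs : ∀ g, Continuous (s g)) (hsT : ∀ k g p, s (k + g) (T k p) = s g p)
    (hone : ∀ p, ∃ g, s g p = 1)
    (hfin : ∀ p, ∃ S : Finset G, ∀ᶠ q in nhds p, ∀ g ∉ S, s g q = 0) :
    ∃ f : P → E, Continuous f ∧ ∀ k p, f (T k p) = k +ᵥ f p := by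
  choose S hS using hfin
  let f : P → E := fun p => coneFold (fun g => s g p) (S p) 0
  have hf : ∀ (p : P) (W : Finset G) (x : E), (∀ g ∉ W, s g p = 0) →
      coneFold (fun g => s g p) W x = f p := by
    intro p W x hW
    obtain ⟨g, hg⟩ := hone p
    have hgW : g ∈ W := by
      by_contra h
      exact one_ne_zero (hg.symm.trans (hW g h))
    rw [coneFold_eq_of_eq_one hgW hg x 0,
      ← coneFold_eq_of_subset (Finset.subset_union_left (s₂ := S p)) hW,
      coneFold_eq_of_subset Finset.subset_union_right (hS p).self_of_nhds]
  refine ⟨f, continuous_iff_continuousAt.2 fun p => ?_, fun k p => ?_⟩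
  · refine (continuous_coneFold hcont hs (S p) (0 : E)).continuousAt.congr ?_
    filter_upwards [hS p] with q hq using hf q _ _ hq
  · rw [← hf (T k p) ((S p).map (addLeftEmbedding k)) (k +ᵥ (0 : E))]
    · exact coneFold_map_addLeft hle (fun g => hsT k g p) _ _
    · intro g hg
      rw [← add_neg_cancel_left k g, hsT]
      refine (hS p).self_of_nhds _ fun h => hg (Finset.mem_map.2 ⟨_, h, ?_⟩)
      simp

end EquivariantMap

section Lattice

variable {n : ℕ}

/-- The inclusion of `ℤⁿ` in Euclidean space. -/
def intVec (g : Fin n → ℤ) : EuclideanSpace ℝ (Fin n) :=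
  WithLp.toLp 2 fun i => (g i : ℝ)

theorem intVec_add (g k : Fin n → ℤ) : intVec (g + k) = intVec g + intVec k := by
  ext i
  simp [intVec]

/-- The unit cube is a compact set meeting every orbit of the translation action of `ℤⁿ`. -/
theorem exists_isCompact_intVec_add (n : ℕ) :
    ∃ Q : Set (EuclideanSpace ℝ (Fin n)), IsCompact Q ∧ ∀ v, ∃ g, ∃ u ∈ Q, v = intVec g + u := by
  refine ⟨WithLp.toLp 2 '' Set.univ.pi fun _ => Set.Icc 0 1,
    (isCompact_univ_pi fun _ => isCompact_Icc).image (PiLp.continuous_toLp 2 _), fun v => ?_⟩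
  refine ⟨fun i => ⌊v i⌋, _, ⟨fun i => Int.fract (v i), fun i _ => ?_, rfl⟩, ?_⟩
  · exact ⟨Int.fract_nonneg _, (Int.fract_lt_one _).le⟩
  · ext i
    simp [intVec]

variable [AddAction (Fin n → ℤ) (EuclideanSpace ℝ (Fin n))]

/-- There is an equivariant map from `ℝⁿ` with the translation action of `ℤⁿ` to `ℝⁿ` with any
given action by homeomorphisms. -/
theorem exists_continuous_map_intVec_add
    (hcont : ∀ g : Fin n → ℤ, Continuous fun x : EuclideanSpace ℝ (Fin n) => g +ᵥ x) :
    ∃ f : EuclideanSpace ℝ (Fin n) → EuclideanSpace ℝ (Fin n), Continuous f ∧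
      ∀ (k : Fin n → ℤ) v, f (intVec k + v) = k +ᵥ f v := by
  let s : (Fin n → ℤ) → EuclideanSpace ℝ (Fin n) → ℝ := fun g v =>
    max 0 (min 1 (2 - ‖(fun i => v i - g i : Fin n → ℝ)‖))
  have hle : ∀ k a b : Fin n → ℤ, toLex a ≤ toLex b ↔ toLex (k + a) ≤ toLex (k + b) := by
    intro k a b
    rw [toLex_add, toLex_add, add_le_add_iff_left]
  refine @exists_equivariant_map _ _ _ _ _ _ (LinearOrder.lift' toLex toLex.injective) _ _
    hle hcont
    (fun k v => intVec k + v) s (fun g => ?_) (fun k g v => ?_) (fun v => ?_) (fun v => ?_)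
  · fun_prop
  · simp [s, intVec]
  · refine ⟨fun i => ⌊v i⌋, ?_⟩
    have : ‖(fun i => v i - ⌊v i⌋ : Fin n → ℝ)‖ ≤ 1 := by
      refine (pi_norm_le_iff_of_nonneg zero_le_one).2 fun i => ?_
      rw [Int.self_sub_floor, Real.norm_of_nonneg (Int.fract_nonneg _)]
      exact (Int.fract_lt_one _).le
    simp only [s]
    rw [min_eq_left (by linarith), max_eq_right zero_le_one]
  · refine ⟨Finset.Icc (fun i => ⌊v i⌋ - 3) (fun i => ⌊v i⌋ + 3), ?_⟩
    filter_upwards [Metric.ball_mem_nhds v one_pos] with w hw g hg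
    by_contra h
    have hwg : ‖(fun i => w i - g i : Fin n → ℝ)‖ < 2 := by
      by_contra! hle
      exact h (max_eq_left (min_le_of_right_le (sub_nonpos.2 hle)))
    have hclose : ∀ i, |v i - g i| < 3 := by
      intro i
      have h1 : ‖w i - g i‖ < 2 :=
        (norm_le_pi_norm (fun i => w i - g i : Fin n → ℝ) i).trans_lt hwg
      have h2 : ‖w i - v i‖ < 1 :=
        (PiLp.norm_apply_le (w - v) i).trans_lt (mem_ball_iff_norm.1 hw)
      rw [Real.norm_eq_abs, abs_lt] at h1 h2
      exact abs_lt.2 ⟨by linarith, by linarith⟩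
    refine hg (Finset.mem_Icc.2 ⟨fun i => ?_, fun i => ?_⟩)
    all_goals
      have h1 := abs_lt.1 (hclose i)
      have h2 := Int.floor_le (v i)
      have h3 := Int.lt_floor_add_one (v i)
    · have : ((⌊v i⌋ - 3 : ℤ) : ℝ) < g i + 1 := by push_cast; linarith
      exact Int.lt_add_one_iff.1 (by exact_mod_cast this)
    · have : (g i : ℝ) < ((⌊v i⌋ + 3 + 1 : ℤ) : ℝ) := by push_cast; linarith
      exact Int.lt_add_one_iff.1 (by exact_mod_cast this)

/-- For a properly discontinuous action of `ℤⁿ` and any radius `r`, there is a map to `ℝⁿ` which is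
within bounded distance of `g` on the `g`-translate of the ball of radius `r`. -/
theorem exists_continuous_norm_sub_intVec_le
    (hcont : ∀ g : Fin n → ℤ, Continuous fun x : EuclideanSpace ℝ (Fin n) => g +ᵥ x)
    (hpd : ∀ K L : Set (EuclideanSpace ℝ (Fin n)), IsCompact K → IsCompact L →
      {g : Fin n → ℤ | (g +ᵥ K) ∩ L ≠ ∅}.Finite) (r : ℝ) :
    ∃ h : EuclideanSpace ℝ (Fin n) → EuclideanSpace ℝ (Fin n), Continuous h ∧
      ∃ M, ∀ (g : Fin n → ℤ) x, ‖x‖ ≤ r → ‖h (g +ᵥ x) - intVec g‖ ≤ M := by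
  let ψ : EuclideanSpace ℝ (Fin n) → ℝ := fun x => max 0 (min 1 (r + 1 - ‖x‖))
  have hψ : Continuous ψ := by fun_prop
  have hψ0 : ∀ x, 0 ≤ ψ x := fun x => le_max_left _ _
  have hψ1 : ∀ x, ‖x‖ ≤ r → ψ x = 1 := fun x hx => by
    simp only [ψ]
    rw [min_eq_left (by linarith), max_eq_right zero_le_one]
  have hψsupp : ∀ x, ψ x ≠ 0 → x ∈ Metric.closedBall (0 : EuclideanSpace ℝ (Fin n)) (r + 1) := by
    intro x hx
    rw [mem_closedBall_zero_iff]
    by_contra! hlt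
    exact hx (max_eq_left (min_le_of_right_le (by linarith)))
  have hfin : ∀ x₀ : EuclideanSpace ℝ (Fin n), ∀ R,
      {g : Fin n → ℤ | ∃ x ∈ Metric.closedBall x₀ R, ψ (-g +ᵥ x) ≠ 0}.Finite := by
    intro x₀ R
    refine (hpd _ _ (isCompact_closedBall 0 (r + 1)) (isCompact_closedBall x₀ R)).subset ?_
    rintro g ⟨x, hx, hgx⟩
    exact Set.Nonempty.ne_empty ⟨x, ⟨_, hψsupp _ hgx, vadd_neg_vadd g x⟩, hx⟩
  have hlf : LocallyFinite fun g : Fin n → ℤ => Function.support fun x => ψ (-g +ᵥ x) := fun x₀ =>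
    ⟨_, Metric.closedBall_mem_nhds x₀ one_pos, (hfin x₀ 1).subset fun g ⟨x, hgx, hx⟩ =>
      ⟨x, hx, hgx⟩⟩
  have hψg : ∀ g : Fin n → ℤ, Continuous fun x => ψ (-g +ᵥ x) := fun g => hψ.comp (hcont (-g))
  let σ : EuclideanSpace ℝ (Fin n) → ℝ := fun x => max 1 (∑ᶠ g : Fin n → ℤ, ψ (-g +ᵥ x))
  have hσ : Continuous σ := continuous_const.max (continuous_finsum hψg hlf)
  have hσpos : ∀ x, 0 < σ x := fun x => lt_max_of_lt_left one_pos
  refine ⟨fun x => ∑ᶠ g : Fin n → ℤ, (ψ (-g +ᵥ x) / σ x) • intVec g, ?_, ?_⟩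
  · refine continuous_finsum
      (fun g => ((hψg g).div hσ fun x => (hσpos x).ne').smul continuous_const)
      (hlf.subset fun g x hx hzero => hx ?_)
    simp only at hzero
    simp [hzero]
  · obtain ⟨M, hM⟩ := Set.exists_upper_bound_image _ (fun g : Fin n → ℤ => ‖intVec g‖) (hfin 0 r)
    refine ⟨‖intVec M‖, fun g x hx => ?_⟩
    rw [← mem_closedBall_iff_norm]
    have hsuppfin : (Function.support fun k : Fin n → ℤ => ψ (-k +ᵥ (g +ᵥ x))).Finite :=
      (hfin (g +ᵥ x) 0).subset fun k hk => ⟨_, Metric.mem_closedBall_self le_rfl, hk⟩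
    have hsum : σ (g +ᵥ x) = ∑ᶠ k : Fin n → ℤ, ψ (-k +ᵥ (g +ᵥ x)) := by
      refine max_eq_right ?_
      have h1 := single_le_finsum g hsuppfin fun k => hψ0 _
      rwa [neg_vadd_vadd, hψ1 x hx] at h1
    refine (convex_closedBall (intVec g) ‖intVec M‖).finsum_mem
      (fun k => div_nonneg (hψ0 _) (hσpos _).le) ?_ fun k hk => ?_
    · simp only [div_eq_mul_inv]
      rw [← finsum_mul' _ _ hsuppfin, ← hsum, mul_inv_cancel₀ (hσpos _).ne']
    · rw [mem_closedBall_iff_norm]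
      have h1 : k - g ∈ {g : Fin n → ℤ | ∃ x ∈ Metric.closedBall
          (0 : EuclideanSpace ℝ (Fin n)) r, ψ (-g +ᵥ x) ≠ 0} := by
        refine ⟨x, mem_closedBall_zero_iff.2 hx, fun hzero => hk ?_⟩
        rw [vadd_vadd, ← sub_eq_neg_add, ← neg_sub, hzero, zero_div]
      have h2 := hM _ h1
      rwa [← sub_add_cancel k g, intVec_add, add_sub_cancel_right]

end Lattice

/-- If `ℤⁿ` acts on `ℝⁿ` by homeomorphisms, continuously, freely and properly
discontinuously, then the orbit space `ℝⁿ/ℤⁿ` is compact. -/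
theorem compact_quotient_of_free_properlyDiscontinuous_zn_action (n : ℕ)
    [AddAction (Fin n → ℤ) (EuclideanSpace ℝ (Fin n))]
    (hcont : ∀ g : Fin n → ℤ, Continuous fun x : EuclideanSpace ℝ (Fin n) => g +ᵥ x)
    (hfree : ∀ (g : Fin n → ℤ) (x : EuclideanSpace ℝ (Fin n)), g +ᵥ x = x → g = 0)
    (hpd : ∀ K L : Set (EuclideanSpace ℝ (Fin n)), IsCompact K → IsCompact L →
      {g : Fin n → ℤ | (g +ᵥ K) ∩ L ≠ ∅}.Finite) :
    CompactSpace
      (Quotient (AddAction.orbitRel (Fin n → ℤ) (EuclideanSpace ℝ (Fin n)))) := by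
  obtain ⟨Q, hQ, hcover⟩ := exists_isCompact_intVec_add n
  obtain ⟨q, hq⟩ := hQ.isBounded.exists_norm_le
  obtain ⟨f, hf, hfg⟩ := exists_continuous_map_intVec_add hcont
  obtain ⟨r, hr⟩ := (hQ.image hf).isBounded.exists_norm_le
  obtain ⟨h, hh, M, hM⟩ := exists_continuous_norm_sub_intVec_le hcont hpd r
  have hsurj : Function.Surjective f := by
    refine surjective_of_coarse_leftInverse hf hh (fun ρ => ?_) (C := M + q) fun v => ?_
    · obtain ⟨N, hN⟩ := Set.exists_upper_bound_image _ (fun g : Fin n → ℤ => ‖intVec g‖)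
        (hpd _ _ (hQ.image hf) (isCompact_closedBall 0 ρ))
      refine ⟨‖intVec N‖ + q, fun v hv => ?_⟩
      obtain ⟨g, u, hu, rfl⟩ := hcover v
      refine (norm_add_le _ _).trans (add_le_add (hN g ?_) (hq u hu))
      rw [hfg] at hv
      exact Set.Nonempty.ne_empty ⟨_, ⟨_, ⟨u, hu, rfl⟩, rfl⟩, mem_closedBall_zero_iff.2 hv⟩
    · obtain ⟨g, u, hu, rfl⟩ := hcover v
      rw [hfg, ← sub_sub]
      exact (norm_sub_le _ _).trans (add_le_add (hM g _ (hr _ ⟨u, hu, rfl⟩)) (hq u hu))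
  refine isCompact_univ_iff.1 (((hQ.image hf).image continuous_quotient_mk').of_isClosed_subset
    isClosed_univ ?_)
  rintro ⟨x⟩ -
  obtain ⟨v, rfl⟩ := hsurj x
  obtain ⟨g, u, hu, rfl⟩ := hcover v
  refine ⟨f u, ⟨u, hu, rfl⟩, Quotient.sound ⟨-g, ?_⟩⟩
  simp [hfg]
end
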